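/- arXiv:1404.3351 — 5 statements merged into one kernel-verified Lean document; each statement's English description precedes it below -/
import Mathlib

section
/- For every odd k ≥ 1, the dimension of h_{g,1}(2k)^{Sp} is the same for all g ≥ k (i.e. dim_ℚ h_{g,1}(2k)^{Sp} = dim_ℚ h_{k,1}(2k)^{Sp} for all g ≥ k); for every even k ≥ 2, the dimension of h_{g,1}(2k)^{Sp} is the same for all g ≥ k−1 (i.e. dim_ℚ h_{g,1}(2k)^{Sp} = dim_ℚ h_{k−1,1}(2k)^{Sp} for all g ≥ k−1). -/
noncomputable section

open Finset

/-! ## The symplectic vector space `H = ℚ^{2g}` and its tensor powers -/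

/-- `H_g = ℚ^{2g}`, with symplectic basis `x_1, y_1, …, x_g, y_g`
(`x_i` at index `2(i-1)`, `y_i` at index `2(i-1)+1`). -/
abbrev HH (g : ℕ) := Fin (2*g) → ℚ

/-- The tensor power `H^{⊗m}`, modelled as coefficient functions on words in the basis. -/
abbrev Tens (g m : ℕ) := (Fin m → Fin (2*g)) → ℚ

/-- index of `x_i` -/
def xI {g : ℕ} (i : Fin g) : Fin (2*g) := ⟨2*i.val, by have := i.isLt; omega⟩
/-- index of `y_i` -/
def yI {g : ℕ} (i : Fin g) : Fin (2*g) := ⟨2*i.val+1, by have := i.isLt; omega⟩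

/-- standard basis vectors of `HH g` -/
def stdB (g : ℕ) (a : Fin (2*g)) : HH g := fun b => if b = a then 1 else 0

/-- the symplectic form `ω` on `HH g` -/
def omegaF {g : ℕ} (u v : HH g) : ℚ :=
  ∑ i : Fin g, (u (xI i) * v (yI i) - u (yI i) * v (xI i))

/-- `ω(e_a , e_b)` on basis vectors -/
def omegaB (g : ℕ) (a b : Fin (2*g)) : ℚ := omegaF (stdB g a) (stdB g b)

/-- the pure tensor `u ⊗ ξ` -/
def oneTmul {g m : ℕ} (u : HH g) (ξ : Tens g m) : Tens g (m+1) :=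
  fun w => u (w 0) * ξ (fun i => w i.succ)

/-- the bracket `[u, ξ] = u ⊗ ξ - ξ ⊗ u` in the tensor algebra -/
def oneBrkt {g m : ℕ} (u : HH g) (ξ : Tens g m) : Tens g (m+1) :=
  fun w => u (w 0) * ξ (fun i => w i.succ)
    - ξ (fun i => w i.castSucc) * u (w (Fin.last m))

/-- left-normed Lie bracket `[u 0, [u 1, [… , u m]…]]` -/
def leftNormed (g : ℕ) : (m : ℕ) → (Fin (m+1) → HH g) → Tens g (m+1)
  | 0, u => fun w => u 0 (w 0)
  | (m+1), u => oneBrkt (u 0) (leftNormed g m (fun i => u i.succ))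

/-- `L_{g,1}(m+1)`: the degree `m+1` part of the free Lie algebra on `HH g`,
i.e. the span of the left-normed brackets, inside `H^{⊗(m+1)}`. -/
def Lsub (g m : ℕ) : Submodule ℚ (Tens g (m+1)) :=
  Submodule.span ℚ (Set.range (leftNormed g m))

/-- the linear extension of `u ⊗ ξ ↦ u ⊗ ξ - ξ ⊗ u` to all of `H^{⊗(m+1)}` -/
def betaFun {g m : ℕ} (t : Tens g (m+1)) : Tens g (m+1) :=
  fun w => t w - t (fun i => Fin.cases (w (Fin.last m)) (fun j => w j.castSucc) i)

/-- `betaFun` as a linear map -/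
def betaL (g m : ℕ) : Tens g (m+1) →ₗ[ℚ] Tens g (m+1) where
  toFun := betaFun
  map_add' a b := by funext w; simp only [betaFun, Pi.add_apply]; ring
  map_smul' c a := by
    funext w
    simp only [betaFun, Pi.smul_apply, smul_eq_mul, RingHom.id_apply]
    ring

/-- `H ⊗ L_{g,1}(k+1)` inside `H^{⊗(k+2)}` -/
def HLsub (g k : ℕ) : Submodule ℚ (Tens g (k+2)) :=
  Submodule.span ℚ {t | ∃ (u : HH g) (ξ : Tens g (k+1)), ξ ∈ Lsub g k ∧ t = oneTmul u ξ}

/-- `h_{g,1}(k) = Ker ([·,·] : H ⊗ L_{g,1}(k+1) → L_{g,1}(k+2))`,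
as a subspace of `H^{⊗(k+2)}`. -/
def hgl (g k : ℕ) : Submodule ℚ (Tens g (k+2)) :=
  HLsub g k ⊓ LinearMap.ker (betaL g (k+1))

/-- the symplectic group `Sp(2g,ℚ)`: linear automorphisms preserving `ω` -/
def SpSet (g : ℕ) : Set (HH g ≃ₗ[ℚ] HH g) :=
  {f | ∀ u v : HH g, omegaF (f u) (f v) = omegaF u v}

/-- the diagonal action of a map `f : H → H` on `H^{⊗m}` -/
def tensMapF {g m : ℕ} (f : HH g → HH g) (t : Tens g m) : Tens g m :=
  fun w' => ∑ w : Fin m → Fin (2*g), t w * ∏ i, f (stdB g (w i)) (w' i)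

/-- the subspace of `Sp(2g,ℚ)`-invariant tensors in `H^{⊗m}` -/
def spInv (g m : ℕ) : Submodule ℚ (Tens g m) where
  carrier := {t | ∀ f : HH g ≃ₗ[ℚ] HH g, f ∈ SpSet g → tensMapF (⇑f) t = t}
  add_mem' := by
    intro a b ha hb f hf
    have h : tensMapF (⇑f) (a + b) = tensMapF (⇑f) a + tensMapF (⇑f) b := by
      funext w'
      simp only [tensMapF, Pi.add_apply, add_mul]
      rw [Finset.sum_add_distrib]
    rw [Set.mem_setOf_eq] at *
    rw [h, ha f hf, hb f hf]
  zero_mem' := by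
    intro f hf
    funext w'
    simp [tensMapF]
  smul_mem' := by
    intro c a ha f hf
    have h : tensMapF (⇑f) (c • a) = c • tensMapF (⇑f) a := by
      funext w'
      simp only [tensMapF, Pi.smul_apply, smul_eq_mul, Finset.mul_sum]
      exact Finset.sum_congr rfl fun w _ => by ring
    rw [h, ha f hf]

/-- the `Sp`-invariant part `h_{g,1}(k)^{Sp}` -/
def hSp (g k : ℕ) : Submodule ℚ (Tens g (k+2)) := hgl g k ⊓ spInv g (k+2)

/-- the symmetric bilinear form `μ^{⊗m}` on `H^{⊗m}` -/
def muF {g m : ℕ} (ξ η : Tens g m) : ℚ :=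
  ∑ w : Fin m → Fin (2*g), ∑ w' : Fin m → Fin (2*g),
    ξ w * η w' * ∏ i, omegaB g (w i) (w' i)

/-! ## The pairing on letters -/

/-- the letter paired with `a` under `ω` -/
def bar {g : ℕ} (a : Fin (2*g)) : Fin (2*g) :=
  if h : a.val % 2 = 0 then ⟨a.val + 1, by have := a.isLt; omega⟩
  else ⟨a.val - 1, by have := a.isLt; omega⟩

/-- the sign `ω(e_a, e_{bar a})` -/
def eps {g : ℕ} (a : Fin (2*g)) : ℚ := if a.val % 2 = 0 then 1 else -1

lemma bar_val {g : ℕ} (a : Fin (2*g)) :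
    (bar a).val = if a.val % 2 = 0 then a.val + 1 else a.val - 1 := by
  unfold bar; split_ifs <;> rfl

@[simp] lemma bar_bar {g : ℕ} (a : Fin (2*g)) : bar (bar a) = a := by
  apply Fin.ext
  rw [bar_val, bar_val]
  split_ifs <;> omega

lemma bar_ne {g : ℕ} (a : Fin (2*g)) : bar a ≠ a := by
  intro h
  have := congrArg Fin.val h
  rw [bar_val] at this
  split_ifs at this <;> omega

lemma bar_eq_iff {g : ℕ} {a b : Fin (2*g)} : bar a = b ↔ a = bar b := by
  constructor <;> rintro rfl <;> simp

@[simp] lemma eps_bar {g : ℕ} (a : Fin (2*g)) : eps (bar a) = - eps a := by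
  unfold eps
  rw [bar_val]
  split_ifs <;> first | omega | norm_num

@[simp] lemma eps_mul_self {g : ℕ} (a : Fin (2*g)) : eps a * eps a = 1 := by
  unfold eps; split_ifs <;> norm_num

lemma omegaF_stdB_left {g : ℕ} (a : Fin (2*g)) (v : HH g) :
    omegaF (stdB g a) v = eps a * v (bar a) := by
  have ha := a.isLt
  unfold omegaF
  rw [Finset.sum_eq_single (⟨a.val / 2, by omega⟩ : Fin g)]
  · by_cases h : a.val % 2 = 0
    · have h1 : xI ⟨a.val / 2, by omega⟩ = a := Fin.ext (by simp [xI]; omega)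
      have h2 : yI ⟨a.val / 2, by omega⟩ = bar a :=
        Fin.ext (by rw [bar_val, if_pos h]; simp [yI]; omega)
      rw [h1, h2]
      simp [stdB, bar_ne, eps, h]
    · have h1 : yI ⟨a.val / 2, by omega⟩ = a := Fin.ext (by simp [yI]; omega)
      have h2 : xI ⟨a.val / 2, by omega⟩ = bar a :=
        Fin.ext (by rw [bar_val, if_neg h]; simp [xI]; omega)
      rw [h1, h2]
      simp [stdB, bar_ne, eps, h]
  · intro i _ hi
    have h1 : xI i ≠ a := by
      rintro rfl; apply hi; apply Fin.ext; simp [xI]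
    have h2 : yI i ≠ a := by
      rintro rfl; apply hi; apply Fin.ext; simp [yI]; omega
    simp [stdB, h1, h2]
  · simp

lemma omegaB_eq {g : ℕ} (a b : Fin (2*g)) :
    omegaB g a b = if b = bar a then eps a else 0 := by
  rw [omegaB, omegaF_stdB_left]
  simp only [stdB, eq_comm (a := b)]
  split_ifs <;> simp

lemma omegaF_add_left {g : ℕ} (u u' v : HH g) :
    omegaF (u + u') v = omegaF u v + omegaF u' v := by
  simp only [omegaF, ← Finset.sum_add_distrib, Pi.add_apply]
  exact Finset.sum_congr rfl fun _ _ => by ring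

lemma omegaF_smul_left {g : ℕ} (c : ℚ) (u v : HH g) : omegaF (c • u) v = c * omegaF u v := by
  simp only [omegaF, Finset.mul_sum, Pi.smul_apply, smul_eq_mul]
  exact Finset.sum_congr rfl fun _ _ => by ring

lemma omegaF_swap {g : ℕ} (u v : HH g) : omegaF v u = - omegaF u v := by
  simp only [omegaF, ← Finset.sum_neg_distrib]
  exact Finset.sum_congr rfl fun _ _ => by ring

lemma omegaF_self {g : ℕ} (v : HH g) : omegaF v v = 0 := by
  have := omegaF_swap v v; linarith

/-! ## Infinitesimal invariance -/

/-- the symplectic transvection `u ↦ u + c ω(u,v) v` -/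
def transvec {g : ℕ} (v : HH g) (c : ℚ) : HH g ≃ₗ[ℚ] HH g where
  toFun u := u + (c * omegaF u v) • v
  invFun u := u + (-c * omegaF u v) • v
  map_add' u u' := by rw [omegaF_add_left]; module
  map_smul' r u := by
    rw [omegaF_smul_left, RingHom.id_apply]; module
  left_inv u := by
    simp only [omegaF_add_left, omegaF_smul_left, omegaF_self]; module
  right_inv u := by
    simp only [omegaF_add_left, omegaF_smul_left, omegaF_self]; module

lemma transvec_apply {g : ℕ} (v u : HH g) (c : ℚ) :
    transvec v c u = u + (c * omegaF u v) • v := rfl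

lemma transvec_mem {g : ℕ} (v : HH g) (c : ℚ) : transvec v c ∈ SpSet g := by
  intro u w
  rw [transvec_apply, transvec_apply, omegaF_add_left, omegaF_smul_left,
    omegaF_swap (w + _) u, omegaF_swap (w + _) v]
  simp only [omegaF_add_left, omegaF_smul_left, omegaF_self]
  rw [omegaF_swap u w, omegaF_swap u v, omegaF_swap v w]
  ring

/-- the derivation of the tensor algebra induced by a matrix unit -/
def unitDer {g n : ℕ} (a b : Fin (2*g)) (t : Tens g n) : Tens g n :=
  fun w => ∑ i, if w i = a then t (Function.update w i b) else 0

/-- the tensors annihilated by the Lie algebra `sp(2g)` -/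
def IsInfInv {g n : ℕ} (t : Tens g n) : Prop :=
  ∀ a b : Fin (2*g), unitDer a b t = (eps a * eps b) • unitDer (bar b) (bar a) t

lemma sum_single_site {g n : ℕ} (t : Tens g n) (w' : Fin n → Fin (2*g)) (i : Fin n)
    (c : Fin (2*g) → ℚ) :
    ∑ w : Fin n → Fin (2*g),
      t w * ((∏ j ∈ Finset.univ.erase i, stdB g (w j) (w' j)) * c (w i)) =
    ∑ a, t (Function.update w' i a) * c a := by
  symm
  apply Finset.sum_of_injOn (fun a => Function.update w' i a)
  · intro a _ b _ h
    have := congrFun h i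
    simpa using this
  · simp
  · intro w _ hw
    have : ∃ j, j ≠ i ∧ w' j ≠ w j := by
      by_contra! h
      apply hw
      refine ⟨w i, by simp, ?_⟩
      funext j
      by_cases hj : j = i
      · subst hj; simp
      · simp [hj, h j hj]
    obtain ⟨j, hj, hj'⟩ := this
    rw [Finset.prod_eq_zero (i := j) (by simp [hj]) (by simp [stdB, hj'])]
    simp
  · intro a _
    rw [Finset.prod_eq_one]
    · simp
    · intro j hj
      simp only [Finset.mem_erase, Finset.mem_univ, and_true] at hj
      simp [stdB, hj]

lemma spInv_transvec_der {g n : ℕ} {t : Tens g n} (ht : t ∈ spInv g n) (v : HH g)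
    (w' : Fin n → Fin (2*g)) :
    ∑ i, ∑ a, t (Function.update w' i a) * (omegaF (stdB g a) v * v (w' i)) = 0 := by
  have hconst : ∀ c : ℚ, ∑ w : Fin n → Fin (2*g), t w *
      ∏ i, (stdB g (w i) (w' i) + c * (omegaF (stdB g (w i)) v * v (w' i))) = t w' := by
    intro c
    have := congrFun (ht (transvec v c) (transvec_mem v c)) w'
    rw [← this]
    simp only [tensMapF, transvec_apply, Pi.add_apply, Pi.smul_apply, smul_eq_mul, mul_assoc]
  have hder : HasDerivAt (fun c : ℚ => ∑ w : Fin n → Fin (2*g), t w *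
      ∏ i, (stdB g (w i) (w' i) + c * (omegaF (stdB g (w i)) v * v (w' i))))
      (∑ w : Fin n → Fin (2*g), t w * ∑ i, (∏ j ∈ Finset.univ.erase i,
        (stdB g (w j) (w' j) + 0 * (omegaF (stdB g (w j)) v * v (w' j)))) •
          (omegaF (stdB g (w i)) v * v (w' i))) 0 := by
    refine HasDerivAt.fun_sum fun w _ => ?_
    apply HasDerivAt.const_mul
    apply HasDerivAt.fun_finsetProd
    intro i _
    apply HasDerivAt.const_add
    simpa using (hasDerivAt_id (0:ℚ)).mul_const (omegaF (stdB g (w i)) v * v (w' i))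
  have h0 : HasDerivAt (fun c : ℚ => ∑ w : Fin n → Fin (2*g), t w *
      ∏ i, (stdB g (w i) (w' i) + c * (omegaF (stdB g (w i)) v * v (w' i)))) 0 0 := by
    simp only [hconst]
    exact hasDerivAt_const _ _
  refine Eq.trans ?_ (hder.unique h0)
  simp only [zero_mul, add_zero, smul_eq_mul, Finset.mul_sum]
  symm
  rw [Finset.sum_comm]
  refine Finset.sum_congr rfl fun i _ => ?_
  exact sum_single_site t w' i (fun a => omegaF (stdB g a) v * v (w' i))

lemma isInfInv_of_mem_spInv {g n : ℕ} {t : Tens g n} (ht : t ∈ spInv g n) : IsInfInv t := by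
  intro a b
  funext w
  have key : ∀ p q : Fin (2*g),
      ∑ i, ∑ c, t (Function.update w i c) * (omegaF (stdB g c) (stdB g p) * stdB g q (w i)) =
        - eps p * unitDer q (bar p) t w := by
    intro p q
    simp only [unitDer, Finset.mul_sum]
    refine Finset.sum_congr rfl fun i _ => ?_
    rw [Finset.sum_eq_single (bar p)]
    · rw [omegaF_stdB_left]
      simp only [stdB]
      split_ifs <;> simp_all [mul_comm]
    · intro c _ hc
      rw [omegaF_stdB_left]
      have : bar c ≠ p := fun h => hc (bar_eq_iff.1 h)
      simp [stdB, this]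
    · simp
  have e1 := spInv_transvec_der ht (stdB g (bar b)) w
  have e2 := spInv_transvec_der ht (stdB g a) w
  have e3 := spInv_transvec_der ht (stdB g (bar b) + stdB g a) w
  have e4 := key (bar b) a
  have e5 := key a (bar b)
  have hadd : ∀ c, omegaF (stdB g c) (stdB g (bar b) + stdB g a) =
      omegaF (stdB g c) (stdB g (bar b)) + omegaF (stdB g c) (stdB g a) := by
    intro c; simp only [omegaF_stdB_left, Pi.add_apply, mul_add]
  simp only [hadd, Pi.add_apply, mul_add, add_mul, Finset.sum_add_distrib] at e3
  simp only [bar_bar, eps_bar, neg_neg] at e4 e5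
  have hb := eps_mul_self b
  simp only [Pi.smul_apply, smul_eq_mul]
  have e6 : eps b * unitDer a b t w = eps a * unitDer (bar b) (bar a) t w := by linarith
  linear_combination (eps b) * e6 - (unitDer a b t w) * hb

lemma unitDer_perm {g n : ℕ} (a b : Fin (2*g)) (t : Tens g n) (σ : Equiv.Perm (Fin n)) :
    unitDer a b (fun w => t (w ∘ σ)) = fun w => unitDer a b t (w ∘ σ) := by
  funext w
  simp only [unitDer]
  rw [← Equiv.sum_comp σ]
  refine Finset.sum_congr rfl fun i _ => ?_
  have : Function.update w (σ i) b ∘ σ = Function.update (w ∘ σ) i b := by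
    funext j
    by_cases h : j = i
    · subst h; simp
    · simp [h]
  rw [this]
  rfl

lemma IsInfInv.perm {g n : ℕ} {t : Tens g n} (ht : IsInfInv t) (σ : Equiv.Perm (Fin n)) :
    IsInfInv (fun w => t (w ∘ σ)) := by
  intro a b
  rw [unitDer_perm, unitDer_perm, ht a b]
  rfl

/-- contraction of the first two tensor factors with `ω` -/
def contr {g n : ℕ} (t : Tens g (n+2)) : Tens g n :=
  fun v => ∑ c, eps c * t (Fin.cons c (Fin.cons (bar c) v : Fin (n+1) → Fin (2*g)))

lemma unitDer_contr {g n : ℕ} (a b : Fin (2*g)) (t : Tens g (n+2)) (v : Fin n → Fin (2*g)) :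
    unitDer a b (contr t) v =
      (∑ c, eps c * unitDer a b t (Fin.cons c (Fin.cons (bar c) v : Fin (n+1) → Fin (2*g))))
      - eps a * t (Fin.cons b (Fin.cons (bar a) v : Fin (n+1) → Fin (2*g)))
      + eps a * t (Fin.cons (bar a) (Fin.cons b v : Fin (n+1) → Fin (2*g))) := by
  have h1 : ∀ c, unitDer a b t (Fin.cons c (Fin.cons (bar c) v : Fin (n+1) → Fin (2*g))) =
      (if c = a then t (Fin.cons b (Fin.cons (bar c) v : Fin (n+1) → Fin (2*g))) else 0) +
      ((if c = bar a then t (Fin.cons c (Fin.cons b v : Fin (n+1) → Fin (2*g))) else 0) +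
      ∑ i, if v i = a then
        t (Fin.cons c (Fin.cons (bar c) (Function.update v i b) : Fin (n+1) → Fin (2*g)))
        else 0) := by
    intro c
    simp only [unitDer, Fin.sum_univ_succ, Fin.cons_zero, Fin.cons_succ, Fin.update_cons_zero,
      ← Fin.cons_update, bar_eq_iff]
  simp only [h1, mul_add, Finset.sum_add_distrib, mul_ite, mul_zero, Finset.sum_ite_eq',
    Finset.mem_univ, if_true, eps_bar]
  have h2 : unitDer a b (contr t) v = ∑ c, eps c * ∑ i, if v i = a then
        t (Fin.cons c (Fin.cons (bar c) (Function.update v i b) : Fin (n+1) → Fin (2*g)))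
        else 0 := by
    simp only [unitDer, contr, Finset.mul_sum]
    rw [Finset.sum_comm]
    refine Finset.sum_congr rfl fun i _ => ?_
    split_ifs <;> simp
  rw [h2]
  ring

lemma IsInfInv.contr {g n : ℕ} {t : Tens g (n+2)} (ht : IsInfInv t) : IsInfInv (contr t) := by
  intro a b
  funext v
  have hb := eps_mul_self b
  simp only [Pi.smul_apply, smul_eq_mul, unitDer_contr, ht a b, bar_bar, eps_bar]
  have : ∑ c, eps c * (eps a * eps b *
        unitDer (bar b) (bar a) t (Fin.cons c (Fin.cons (bar c) v : Fin (n+1) → Fin (2*g)))) =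
      eps a * eps b * ∑ c, eps c *
        unitDer (bar b) (bar a) t (Fin.cons c (Fin.cons (bar c) v : Fin (n+1) → Fin (2*g))) := by
    rw [Finset.mul_sum]
    exact Finset.sum_congr rfl fun _ _ => by ring
  rw [this]
  linear_combination eps a * (t (Fin.cons b (Fin.cons (bar a) v : Fin (n+1) → Fin (2*g)))
    - t (Fin.cons (bar a) (Fin.cons b v : Fin (n+1) → Fin (2*g)))) * hb

/-! ## The first fundamental theorem -/

/-- the span of the tensors given by complete chord diagrams on `n` points -/
def chordSpan (g : ℕ) : (n : ℕ) → Submodule ℚ (Tens g n)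
  | 0 => ⊤
  | 1 => ⊥
  | n+2 => Submodule.span ℚ {t | ∃ σ : Equiv.Perm (Fin (n+2)), ∃ s ∈ chordSpan g n,
      t = fun w => omegaB g (w (σ 0)) (w (σ 1)) * s (fun i => w (σ i.succ.succ))}

lemma chordSpan_perm {g : ℕ} : ∀ {n : ℕ} {t : Tens g n} (_ : t ∈ chordSpan g n)
    (τ : Equiv.Perm (Fin n)), (fun w => t (w ∘ τ)) ∈ chordSpan g n
  | 0, _, _, _ => Submodule.mem_top
  | 1, t, ht, τ => by
      have : t = 0 := ht
      subst this
      exact Submodule.zero_mem _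
  | n+2, t, ht, τ => by
      refine Submodule.span_induction (p := fun t _ => (fun w => t (w ∘ τ)) ∈ chordSpan g (n+2))
        ?_ ?_ ?_ ?_ ht
      · rintro _ ⟨σ, s, hs, rfl⟩
        exact Submodule.subset_span ⟨τ * σ, s, hs, rfl⟩
      · exact Submodule.zero_mem _
      · intro x y _ _ hx hy
        exact Submodule.add_mem _ hx hy
      · intro c x _ hx
        exact Submodule.smul_mem _ c hx

/-- the Casimir element of `gl(2g)`, acting on tensors -/
def casimir {g n : ℕ} (t : Tens g n) : Tens g n :=
  fun w => ∑ a, ∑ b, unitDer b a (unitDer a b t) w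

lemma sum_unitDer {g n : ℕ} (F : Fin (2*g) → Fin (2*g) → Tens g n) (w : Fin n → Fin (2*g)) :
    ∑ a, ∑ b, unitDer b a (F a b) w = ∑ i, ∑ a, F a (w i) (Function.update w i a) := by
  rw [Finset.sum_comm (s := (Finset.univ : Finset (Fin n)))]
  refine Finset.sum_congr rfl fun a _ => ?_
  simp only [unitDer]
  rw [Finset.sum_comm]
  simp

lemma casimir_apply {g n : ℕ} (t : Tens g n) (w : Fin n → Fin (2*g)) :
    casimir t w = (2*g*n : ℚ) * t w +
      ∑ i, ∑ j ∈ Finset.univ.erase i, t (w ∘ Equiv.swap i j) := by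
  have h1 : casimir t w = ∑ i, ∑ a, ∑ j, if Function.update w i a j = a then
      t (Function.update (Function.update w i a) j (w i)) else 0 := by
    simp only [casimir, sum_unitDer]
    rfl
  have h2 : ∀ i : Fin n, ∑ a, ∑ j, (if Function.update w i a j = a then
      t (Function.update (Function.update w i a) j (w i)) else 0) =
      2*g * t w + ∑ j ∈ Finset.univ.erase i, t (w ∘ Equiv.swap i j) := by
    intro i
    rw [Finset.sum_comm, ← Finset.add_sum_erase _ _ (Finset.mem_univ i)]
    congr 1
    · simp
    · refine Finset.sum_congr rfl fun j hj => ?_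
      have hj' : j ≠ i := (Finset.mem_erase.1 hj).1
      simp only [Function.update_of_ne hj', Finset.sum_ite_eq, Finset.mem_univ, if_true]
      congr 1
      rw [Equiv.comp_swap_eq_update]
      rw [Function.update_comm hj'.symm]
  rw [h1]
  simp only [h2, Finset.sum_add_distrib, Finset.sum_const, Finset.card_univ, Fintype.card_fin,
    nsmul_eq_mul]
  ring

lemma IsInfInv.casimir_eq {g n : ℕ} {t : Tens g n} (ht : IsInfInv t) (w : Fin n → Fin (2*g)) :
    casimir t w = -(n : ℚ) * t w + ∑ i, ∑ j ∈ Finset.univ.erase i, omegaB g (w i) (w j) *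
      ∑ a, eps a * t (Function.update (Function.update w i a) j (bar a)) := by
  have h1 : casimir t w = ∑ i, ∑ a, eps a * eps (w i) *
      ∑ j, if Function.update w i a j = bar (w i) then
      t (Function.update (Function.update w i a) j (bar a)) else 0 := by
    have : ∀ a b, unitDer a b t = (eps a * eps b) • unitDer (bar b) (bar a) t := ht
    simp only [casimir]
    have h : ∀ a b, unitDer b a (unitDer a b t) w =
        unitDer b a ((eps a * eps b) • unitDer (bar b) (bar a) t) w := by
      intro a b; rw [← ht a b]
    simp only [h, sum_unitDer (fun a b => (eps a * eps b) • unitDer (bar b) (bar a) t)]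
    rfl
  have h2 : ∀ i : Fin n, ∑ a, eps a * eps (w i) *
      (∑ j, if Function.update w i a j = bar (w i) then
      t (Function.update (Function.update w i a) j (bar a)) else 0) =
      - t w + ∑ j ∈ Finset.univ.erase i, omegaB g (w i) (w j) *
        ∑ a, eps a * t (Function.update (Function.update w i a) j (bar a)) := by
    intro i
    simp only [Finset.mul_sum]
    rw [Finset.sum_comm, ← Finset.add_sum_erase _ _ (Finset.mem_univ i)]
    congr 1
    · simp [Finset.sum_ite_eq']
    · refine Finset.sum_congr rfl fun j hj => ?_
      have hj' : j ≠ i := (Finset.mem_erase.1 hj).1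
      refine Finset.sum_congr rfl fun a _ => ?_
      rw [Function.update_of_ne hj', omegaB_eq]
      split_ifs <;> ring
  rw [h1]
  simp only [h2, Finset.sum_add_distrib, Finset.sum_const, Finset.card_univ, Fintype.card_fin,
    nsmul_eq_mul]
  ring

lemma unitDer_dotProduct {g n : ℕ} (a b : Fin (2*g)) (s t : Tens g n) :
    unitDer a b s ⬝ᵥ t = s ⬝ᵥ unitDer b a t := by
  simp only [dotProduct, unitDer, Finset.sum_mul, Finset.mul_sum]
  rw [Finset.sum_comm]
  symm
  rw [Finset.sum_comm]
  refine Finset.sum_congr rfl fun i _ => ?_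
  simp only [ite_mul, zero_mul, mul_ite, mul_zero]
  rw [← Finset.sum_filter, ← Finset.sum_filter]
  refine Finset.sum_nbij' (fun w => Function.update w i a) (fun w => Function.update w i b)
    ?_ ?_ ?_ ?_ ?_ <;> intro w hw <;> simp only [Finset.mem_filter, Finset.mem_univ, true_and] at hw
  · simp
  · simp
  · simp [← hw]
  · simp [← hw]
  · simp [← hw]

lemma casimir_pos {g n : ℕ} (t : Tens g n) : 0 ≤ t ⬝ᵥ casimir t := by
  have : casimir t = ∑ a, ∑ b, unitDer b a (unitDer a b t) := by
    funext w; simp [casimir]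
  rw [this]
  simp only [dotProduct_sum]
  refine Finset.sum_nonneg fun a _ => Finset.sum_nonneg fun b _ => ?_
  rw [← unitDer_dotProduct]
  exact Finset.sum_nonneg fun w _ => mul_self_nonneg _

/-- the operator `n + casimir`, which is positive definite for `n > 0` -/
def shiftedCasimir (g n : ℕ) : Tens g n →ₗ[ℚ] Tens g n where
  toFun t := (n : ℚ) • t + casimir t
  map_add' s t := by
    funext w
    simp only [Pi.add_apply, Pi.smul_apply, smul_eq_mul, casimir_apply, mul_add,
      Finset.sum_add_distrib]
    ring
  map_smul' c t := by
    funext w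
    simp only [Pi.add_apply, Pi.smul_apply, smul_eq_mul, casimir_apply, ← Finset.mul_sum,
      RingHom.id_apply]
    ring

lemma shiftedCasimir_apply {g n : ℕ} (t : Tens g n) :
    shiftedCasimir g n t = (n : ℚ) • t + casimir t := rfl

lemma shiftedCasimir_injective {g n : ℕ} (hn : 0 < n) :
    Function.Injective (shiftedCasimir g n) := by
  rw [← LinearMap.ker_eq_bot, LinearMap.ker_eq_bot']
  intro t ht
  have h := congrArg (fun s => t ⬝ᵥ s) ht
  simp only [shiftedCasimir_apply, dotProduct_add, dotProduct_smul, smul_eq_mul,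
    dotProduct_zero] at h
  have h1 := casimir_pos t
  have h2 : 0 ≤ t ⬝ᵥ t := Finset.sum_nonneg fun w _ => mul_self_nonneg _
  have h3 : (0:ℚ) < n := by exact_mod_cast hn
  apply dotProduct_self_eq_zero.1
  nlinarith

lemma shiftedCasimir_mem {g n : ℕ} {t : Tens g n} (ht : t ∈ chordSpan g n) :
    shiftedCasimir g n t ∈ chordSpan g n := by
  have : shiftedCasimir g n t = (n + 2*g*n : ℚ) • t +
      ∑ i, ∑ j ∈ Finset.univ.erase i, fun w => t (w ∘ Equiv.swap i j) := by
    funext w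
    simp only [shiftedCasimir_apply, Pi.add_apply, Pi.smul_apply, smul_eq_mul, casimir_apply,
      Finset.sum_apply]
    ring
  rw [this]
  exact Submodule.add_mem _ (Submodule.smul_mem _ _ ht)
    (Submodule.sum_mem _ fun i _ => Submodule.sum_mem _ fun j _ => chordSpan_perm ht _)

lemma mem_of_shiftedCasimir_mem {g n : ℕ} (hn : 0 < n) {t : Tens g n}
    (ht : shiftedCasimir g n t ∈ chordSpan g n) : t ∈ chordSpan g n := by
  have hinj : Function.Injective
      ((shiftedCasimir g n).restrict (p := chordSpan g n) (q := chordSpan g n)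
        fun _ h => shiftedCasimir_mem h) := by
    intro x y hxy
    exact Subtype.ext (shiftedCasimir_injective hn (congrArg Subtype.val hxy))
  obtain ⟨y, hy⟩ := LinearMap.injective_iff_surjective.1 hinj ⟨_, ht⟩
  have := shiftedCasimir_injective hn (congrArg Subtype.val hy)
  rw [← this]
  exact y.2

lemma exists_perm_zero_one {n : ℕ} {i j : Fin (n+2)} (h : j ≠ i) :
    ∃ σ : Equiv.Perm (Fin (n+2)), σ 0 = i ∧ σ 1 = j := by
  have : Equiv.swap 0 i j ≠ 0 := by
    intro h'
    apply h
    have := congrArg (Equiv.swap 0 i) h'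
    simpa using this
  refine ⟨Equiv.swap 0 i * Equiv.swap 1 (Equiv.swap 0 i j), ?_, ?_⟩
  · rw [Equiv.Perm.mul_apply, Equiv.swap_apply_of_ne_of_ne (a := 1) (by simp) this.symm]
    simp
  · simp

/-- The first fundamental theorem of invariant theory for `sp(2g)`, in multilinear form. -/
theorem IsInfInv.mem_chordSpan {g : ℕ} : ∀ {n : ℕ} {t : Tens g n}, IsInfInv t → t ∈ chordSpan g n
  | 0, _, _ => Submodule.mem_top
  | 1, t, ht => by
      apply mem_of_shiftedCasimir_mem one_pos
      convert Submodule.zero_mem _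
      funext w
      rw [shiftedCasimir_apply, Pi.add_apply, ht.casimir_eq]
      simp
  | n+2, t, ht => by
      apply mem_of_shiftedCasimir_mem (by omega)
      have : shiftedCasimir g (n+2) t = ∑ i, ∑ j ∈ Finset.univ.erase i,
          fun w => omegaB g (w i) (w j) *
            ∑ a, eps a * t (Function.update (Function.update w i a) j (bar a)) := by
        funext w
        rw [shiftedCasimir_apply, Pi.add_apply, ht.casimir_eq]
        simp [Finset.sum_apply]
        ring
      rw [this]
      refine Submodule.sum_mem _ fun i _ => Submodule.sum_mem _ fun j hj => ?_
      obtain ⟨σ, rfl, rfl⟩ := exists_perm_zero_one (Finset.mem_erase.1 hj).1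
      refine Submodule.subset_span ⟨σ, _, ((ht.perm σ⁻¹).contr).mem_chordSpan, ?_⟩
      funext w
      congr 1
      refine Finset.sum_congr rfl fun a _ => ?_
      congr 2
      funext x
      obtain ⟨y, rfl⟩ := σ.surjective x
      simp only [Function.comp, ← Equiv.Perm.mul_apply, inv_mul_cancel, Equiv.Perm.one_apply]
      refine Fin.cases ?_ (fun y => Fin.cases ?_ (fun y => ?_) y) y
      · rw [Function.update_of_ne (by simp)]; simp
      · simp
      · rw [Function.update_of_ne, Function.update_of_ne]
        · simp
        · intro h; simpa using σ.injective h
        · intro h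
          have := σ.injective h
          rw [Fin.ext_iff] at this
          simp at this

/-! ## Chord tensors are invariant -/

lemma omegaF_eq_sum {g : ℕ} (u v : HH g) : omegaF u v = ∑ a, eps a * u a * v (bar a) := by
  let L : HH g →ₗ[ℚ] ℚ :=
    { toFun := fun u => omegaF u v
      map_add' := fun u u' => omegaF_add_left u u' v
      map_smul' := fun c u => omegaF_smul_left c u v }
  have := L.pi_apply_eq_sum_univ u
  change omegaF u v = ∑ a, u a • omegaF (fun j => if a = j then 1 else 0) v at this
  rw [this]
  refine Finset.sum_congr rfl fun a _ => ?_
  have h : (fun j => if a = j then (1:ℚ) else 0) = stdB g a := by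
    funext j; simp [stdB, eq_comm]
  rw [h, omegaF_stdB_left, smul_eq_mul]
  ring

lemma sum_omegaB_map {g : ℕ} {f : HH g ≃ₗ[ℚ] HH g} (hf : f ∈ SpSet g) (c d : Fin (2*g)) :
    ∑ a, ∑ b, omegaB g a b * (f (stdB g a) c * f (stdB g b) d) = omegaB g c d := by
  let M : Matrix (Fin (2*g)) (Fin (2*g)) ℚ := Matrix.of fun c a => f (stdB g a) c
  let J : Matrix (Fin (2*g)) (Fin (2*g)) ℚ := Matrix.of (omegaB g)
  have hJ : J * J = -1 := by
    ext a b
    rw [Matrix.mul_apply, Finset.sum_eq_single (bar a)]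
    · simp only [J, Matrix.of_apply, omegaB_eq, bar_bar, Matrix.neg_apply, Matrix.one_apply,
        eps_bar, eq_comm (a := b)]
      split_ifs <;> simp
    · intro x _ hx
      simp [J, omegaB_eq, hx]
    · simp
  have hM : M.transpose * J * M = J := by
    ext a b
    have h := hf (stdB g a) (stdB g b)
    rw [omegaF_eq_sum] at h
    simp only [Matrix.mul_apply, Matrix.transpose_apply, Finset.sum_mul]
    rw [Finset.sum_comm]
    refine Eq.trans (Finset.sum_congr rfl fun x _ => ?_) h
    rw [Finset.sum_eq_single (bar x)]
    · simp only [M, J, Matrix.of_apply, omegaB_eq, if_true]; ring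
    · intro y _ hy
      simp [J, omegaB_eq, hy]
    · simp
  have h1 : (-(J * M.transpose * J)) * M = 1 := by
    rw [neg_mul, mul_assoc J, mul_assoc J, hM, hJ, neg_neg]
  have h2 : M * J * M.transpose = J := by
    have h3 := mul_eq_one_comm.1 h1
    have h4 : M * J * M.transpose * J * J = - J := by
      calc M * J * M.transpose * J * J = -(M * (-(J * M.transpose * J))) * J := by
            simp only [mul_neg, neg_neg, mul_assoc]
        _ = -J := by rw [h3]; simp
    rw [mul_assoc _ J J, hJ] at h4
    simpa using h4
  have h5 := congrFun (congrFun h2 c) d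
  simp only [Matrix.mul_apply, Matrix.transpose_apply, Finset.sum_mul] at h5
  rw [Finset.sum_comm]
  refine Eq.trans (Finset.sum_congr rfl fun x _ => Finset.sum_congr rfl fun y _ => ?_) h5
  simp [M, J]; ring

lemma sum_words_succ_succ {g n : ℕ} (F : (Fin (n+2) → Fin (2*g)) → ℚ) :
    ∑ w, F w = ∑ a, ∑ b, ∑ v : Fin n → Fin (2*g),
      F (Fin.cons a (Fin.cons b v : Fin (n+1) → Fin (2*g))) := by
  rw [← (Fin.consEquiv (fun _ : Fin (n+2) => Fin (2*g))).sum_comp, Fintype.sum_prod_type]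
  refine Finset.sum_congr rfl fun a _ => ?_
  rw [← (Fin.consEquiv (fun _ : Fin (n+1) => Fin (2*g))).sum_comp, Fintype.sum_prod_type]
  rfl

lemma chordSpan_le_spInv (g : ℕ) : ∀ n, chordSpan g n ≤ spInv g n
  | 0 => by
      intro t _ f _
      funext w'
      simp only [tensMapF, Finset.univ_unique, Finset.sum_singleton, Finset.univ_eq_empty,
        Finset.prod_empty, mul_one]
      exact congrArg t (Subsingleton.elim _ _)
  | 1 => bot_le
  | n+2 => by
      refine Submodule.span_le.2 ?_
      rintro _ ⟨σ, s, hs, rfl⟩ f hf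
      have ih := chordSpan_le_spInv g n hs f hf
      funext w'
      have ih' := congrFun ih (fun i => w' (σ i.succ.succ))
      simp only [tensMapF] at ih' ⊢
      rw [← (Equiv.arrowCongr σ (Equiv.refl (Fin (2*g)))).sum_comp, ← ih',
        ← sum_omegaB_map hf, sum_words_succ_succ]
      simp only [Finset.sum_mul]
      refine Finset.sum_congr rfl fun a _ => Finset.sum_congr rfl fun b _ => ?_
      rw [Finset.mul_sum]
      refine Finset.sum_congr rfl fun v _ => ?_
      rw [← Equiv.prod_comp σ]
      simp [Equiv.arrowCongr, Fin.prod_univ_succ]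
      ring

lemma spInv_eq_chordSpan (g n : ℕ) : spInv g n = chordSpan g n :=
  le_antisymm (fun _ ht => (isInfInv_of_mem_spInv ht).mem_chordSpan) (chordSpan_le_spInv g n)

/-! ## Change of the symplectic space -/

/-- a map of letters inducing a symplectic embedding -/
def PreservesOmega {g g' : ℕ} (s : Fin (2*g) → Fin (2*g')) : Prop :=
  ∀ a b, omegaB g' (s a) (s b) = omegaB g a b

/-- pullback of coefficient functions along a map of letters -/
def pullback {g g' : ℕ} (n : ℕ) (s : Fin (2*g) → Fin (2*g')) : Tens g' n →ₗ[ℚ] Tens g n :=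
  LinearMap.funLeft ℚ ℚ (fun w : Fin n → Fin (2*g) => s ∘ w)

lemma pullback_apply {g g' n : ℕ} (s : Fin (2*g) → Fin (2*g')) (t : Tens g' n)
    (w : Fin n → Fin (2*g)) : pullback n s t w = t (s ∘ w) := rfl

lemma map_pullback_chordSpan {g g' : ℕ} {s : Fin (2*g) → Fin (2*g')} (hs : PreservesOmega s) :
    ∀ n, (chordSpan g' n).map (pullback n s) = chordSpan g n
  | 0 => by
      refine eq_top_iff.2 fun t _ => ⟨fun _ => t (fun i => i.elim0), Submodule.mem_top, ?_⟩
      funext w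
      exact congrArg t (Subsingleton.elim _ _)
  | 1 => Submodule.map_bot _
  | n+2 => by
      have ih := map_pullback_chordSpan hs n
      simp only [chordSpan, Submodule.map_span]
      congr 1
      ext t
      constructor
      · rintro ⟨_, ⟨σ, u, hu, rfl⟩, rfl⟩
        refine ⟨σ, pullback n s u, ih ▸ Submodule.mem_map_of_mem hu, ?_⟩
        funext w
        simp only [pullback_apply, Function.comp_apply, hs _ _]
        rfl
      · rintro ⟨σ, u, hu, rfl⟩
        rw [← ih] at hu
        obtain ⟨v, hv, rfl⟩ := hu
        refine ⟨_, ⟨σ, v, hv, rfl⟩, ?_⟩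
        funext w
        simp only [pullback_apply, Function.comp_apply, hs _ _]
        rfl

lemma pullback_congr {g g' : ℕ} {s s' : Fin (2*g) → Fin (2*g')} (hs : PreservesOmega s)
    (hs' : PreservesOmega s') : ∀ {n : ℕ} {t : Tens g' n} (_ : t ∈ chordSpan g' n),
      pullback n s t = pullback n s' t
  | 0, t, _ => by
      funext w
      exact congrArg t (Subsingleton.elim _ _)
  | 1, t, ht => by
      have : t = 0 := ht
      simp [this]
  | n+2, t, ht => by
      refine LinearMap.eqOn_span ?_ ht
      rintro _ ⟨σ, u, hu, rfl⟩
      have ih := pullback_congr hs hs' hu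
      funext w
      have ih' := congrFun ih (fun i => w (σ i.succ.succ))
      simp only [pullback_apply, Function.comp_apply, hs _ _, hs' _ _]
      exact congrArg _ ih'

/-! ## Linear combinations of place permutations -/

open Equiv (Perm)

/-- the operator on `H^{⊗n}` given by a combination of place permutations -/
def op {g n : ℕ} (a : Perm (Fin n) → ℚ) : Tens g n →ₗ[ℚ] Tens g n :=
  ∑ σ, a σ • LinearMap.funLeft ℚ ℚ (fun w : Fin n → Fin (2*g) => w ∘ σ)

lemma op_apply {g n : ℕ} (a : Perm (Fin n) → ℚ) (t : Tens g n) (w : Fin n → Fin (2*g)) :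
    op a t w = ∑ σ, a σ * t (w ∘ σ) := by
  simp [op, LinearMap.sum_apply, Finset.sum_apply, LinearMap.funLeft_apply]

lemma op_op {g n : ℕ} (a b : Perm (Fin n) → ℚ) (t : Tens g n) :
    op a (op b t) = op (fun ρ => ∑ σ, a σ * b (σ⁻¹ * ρ)) t := by
  funext w
  simp only [op_apply, Finset.mul_sum, Finset.sum_mul]
  rw [Finset.sum_comm (s := univ (α := Perm (Fin n))) (t := univ (α := Perm (Fin n)))
    (f := fun x y => a y * b (y⁻¹ * x) * t (w ∘ x))]
  refine Finset.sum_congr rfl fun σ _ => ?_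
  rw [← Equiv.sum_comp (Equiv.mulLeft σ) (fun x => a σ * b (σ⁻¹ * x) * t (w ∘ x))]
  refine Finset.sum_congr rfl fun τ _ => ?_
  simp only [Equiv.coe_mulLeft, inv_mul_cancel_left, mul_assoc]
  rfl

/-- the coefficients of the adjoint operator -/
def adj {n : ℕ} (a : Perm (Fin n) → ℚ) : Perm (Fin n) → ℚ := fun σ => a σ⁻¹

lemma adj_adj {n : ℕ} (a : Perm (Fin n) → ℚ) : adj (adj a) = a := by
  funext σ; simp [adj]

lemma op_dotProduct {g n : ℕ} (a : Perm (Fin n) → ℚ) (s t : Tens g n) :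
    op a s ⬝ᵥ t = s ⬝ᵥ op (adj a) t := by
  simp only [dotProduct, op_apply, Finset.sum_mul, Finset.mul_sum]
  rw [Finset.sum_comm]
  conv_rhs => rw [Finset.sum_comm]
  rw [← Equiv.sum_comp (Equiv.inv (Perm (Fin n)))]
  refine Finset.sum_congr rfl fun σ _ => ?_
  rw [← Equiv.sum_comp (Equiv.arrowCongr σ⁻¹ (Equiv.refl (Fin (2*g))))]
  refine Finset.sum_congr rfl fun w _ => ?_
  simp only [Equiv.inv_apply, adj]
  have h1 : (Equiv.arrowCongr σ⁻¹ (Equiv.refl (Fin (2*g)))) w = w ∘ σ := rfl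
  have h2 : (w ∘ σ) ∘ ⇑σ⁻¹ = w := by
    funext i
    change w (σ (σ⁻¹ i)) = w i
    rw [← Equiv.Perm.mul_apply, mul_inv_cancel, Equiv.Perm.one_apply]
  rw [h1, h2]
  ring

lemma op_eq_zero_of_adj {g n : ℕ} {a : Perm (Fin n) → ℚ} {s : Tens g n}
    (h : op (adj a) (op a s) = 0) : op a s = 0 := by
  rw [← dotProduct_self_eq_zero, op_dotProduct, h, dotProduct_zero]

lemma op_pullback {g g' n : ℕ} (s : Fin (2*g) → Fin (2*g')) (a : Perm (Fin n) → ℚ)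
    (t : Tens g' n) : op a (pullback n s t) = pullback n s (op a t) := by
  funext w
  simp only [op_apply, pullback_apply]
  rfl

lemma op_mem_spInv {g n : ℕ} (a : Perm (Fin n) → ℚ) {t : Tens g n} (ht : t ∈ spInv g n) :
    op a t ∈ spInv g n := by
  rw [spInv_eq_chordSpan] at *
  rw [op, LinearMap.sum_apply]
  exact Submodule.sum_mem _ fun σ _ => Submodule.smul_mem _ _ (chordSpan_perm ht σ)

/-- Solving `b b* b z = b s` inside the invariants. -/
lemma exists_op_sub_eq_zero {g n : ℕ} (b : Perm (Fin n) → ℚ) {s : Tens g n}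
    (hs : s ∈ spInv g n) :
    ∃ z ∈ spInv g n, op b (s - op (adj b) (op b z)) = 0 := by
  let B : spInv g n →ₗ[ℚ] spInv g n := (op b).restrict fun _ h => op_mem_spInv b h
  let B' : spInv g n →ₗ[ℚ] spInv g n :=
    (op (adj b)).restrict fun _ h => op_mem_spInv (adj b) h
  have hle : LinearMap.range (B ∘ₗ B' ∘ₗ B) ≤ LinearMap.range B := LinearMap.range_comp_le_range _ _
  have hker : LinearMap.ker (B ∘ₗ B' ∘ₗ B) = LinearMap.ker B := by
    refine le_antisymm (fun z hz => ?_) (LinearMap.ker_le_ker_comp B (B ∘ₗ B'))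
    have h1 : op b (op (adj b) (op b z.1)) = 0 := congrArg Subtype.val hz
    have h2 : op (adj b) (op b z.1) = 0 := by
      refine op_eq_zero_of_adj (a := adj b) ?_
      rw [adj_adj, h1]
    exact Subtype.ext (op_eq_zero_of_adj h2)
  have heq : LinearMap.range (B ∘ₗ B' ∘ₗ B) = LinearMap.range B := by
    refine Submodule.eq_of_le_of_finrank_eq hle ?_
    have h1 := LinearMap.finrank_range_add_finrank_ker (B ∘ₗ B' ∘ₗ B)
    have h2 := LinearMap.finrank_range_add_finrank_ker B
    rw [hker] at h1
    omega
  have hm : B ⟨s, hs⟩ ∈ LinearMap.range (B ∘ₗ B' ∘ₗ B) := heq ▸ LinearMap.mem_range_self B _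
  obtain ⟨z, hz⟩ := hm
  refine ⟨z.1, z.2, ?_⟩
  have : op b (op (adj b) (op b z.1)) = op b s := congrArg Subtype.val hz
  rw [map_sub, this, sub_self]

lemma exists_mem_spInv_op_eq {g n : ℕ} (b : Perm (Fin n) → ℚ) {t : Tens g n}
    (ht : t ∈ spInv g n) (hb : t ∈ LinearMap.range (op (g := g) b)) :
    ∃ s ∈ spInv g n, op b s = t := by
  obtain ⟨z, hz, h⟩ := exists_op_sub_eq_zero (adj b) ht
  rw [adj_adj] at h
  obtain ⟨y, rfl⟩ := hb
  refine ⟨op (adj b) z, op_mem_spInv _ hz, ?_⟩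
  rw [← map_sub] at h
  have := op_eq_zero_of_adj h
  rw [map_sub, sub_eq_zero] at this
  exact this.symm

lemma exists_lift_ker_op {g g' n : ℕ} {s : Fin (2*g) → Fin (2*g')} (hs : PreservesOmega s)
    (b : Perm (Fin n) → ℚ) {t : Tens g n} (ht : t ∈ spInv g n) (hb : op b t = 0) :
    ∃ T ∈ spInv g' n, pullback n s T = t ∧ op b T = 0 := by
  have h0 : t ∈ (spInv g' n).map (pullback n s) := by
    rwa [spInv_eq_chordSpan, map_pullback_chordSpan hs, ← spInv_eq_chordSpan]
  obtain ⟨S, hS, rfl⟩ := h0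
  obtain ⟨z, hz, h⟩ := exists_op_sub_eq_zero b hS
  refine ⟨S - op (adj b) (op b z), sub_mem hS (op_mem_spInv _ (op_mem_spInv _ hz)), ?_, h⟩
  have h1 : op b (pullback n s S) - op b (op (adj b) (op b (pullback n s z))) = 0 := by
    rw [op_pullback, op_pullback, op_pullback, op_pullback, ← map_sub, ← map_sub, h, map_zero]
  rw [hb, zero_sub, neg_eq_zero] at h1
  have h2 : op (adj b) (op b (pullback n s z)) = 0 := by
    refine op_eq_zero_of_adj (a := adj b) ?_
    rw [adj_adj, h1]
  rw [map_sub, ← op_pullback, ← op_pullback, h2, sub_zero]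

/-! ## The Lie spaces as images of place permutation operators -/

/-- extension of a permutation of the last `n` places -/
def liftPerm {n : ℕ} (σ : Perm (Fin n)) : Perm (Fin (n+1)) :=
  Equiv.Perm.decomposeFin.symm (0, σ)

@[simp] lemma liftPerm_zero {n : ℕ} (σ : Perm (Fin n)) : liftPerm σ 0 = 0 := by
  simp [liftPerm]

@[simp] lemma liftPerm_succ {n : ℕ} (σ : Perm (Fin n)) (i : Fin n) :
    liftPerm σ i.succ = (σ i).succ := by
  simp [liftPerm]

lemma sign_liftPerm {n : ℕ} (σ : Perm (Fin n)) :
    Equiv.Perm.sign (liftPerm σ) = Equiv.Perm.sign σ := by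
  simp [liftPerm, Equiv.Perm.decomposeFin.symm_sign]

/-- the coefficients of `id ⊗ op a` -/
def liftCoeff {n : ℕ} (a : Perm (Fin n) → ℚ) : Perm (Fin (n+1)) → ℚ :=
  fun ρ => ∑ σ, if ρ = liftPerm σ then a σ else 0

lemma op_liftCoeff_apply {g n : ℕ} (a : Perm (Fin n) → ℚ) (t : Tens g (n+1))
    (w : Fin (n+1) → Fin (2*g)) :
    op (liftCoeff a) t w = ∑ σ, a σ * t (w ∘ liftPerm σ) := by
  simp only [op_apply, liftCoeff, Finset.sum_mul]
  rw [Finset.sum_comm]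
  exact Finset.sum_congr rfl fun σ _ => by simp

lemma op_liftCoeff_oneTmul {g n : ℕ} (a : Perm (Fin n) → ℚ) (u : HH g) (ξ : Tens g n) :
    op (liftCoeff a) (oneTmul u ξ) = oneTmul u (op a ξ) := by
  funext w
  rw [op_liftCoeff_apply]
  simp only [oneTmul, op_apply, Finset.mul_sum, Function.comp_apply, liftPerm_zero,
    liftPerm_succ]
  exact Finset.sum_congr rfl fun σ _ => mul_left_comm _ _ _

lemma sum_oneTmul {g n : ℕ} (t : Tens g (n+1)) :
    t = ∑ a, oneTmul (stdB g a) (fun v => t (Fin.cons a v)) := by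
  funext w
  simp only [Finset.sum_apply, oneTmul, stdB]
  simp only [ite_mul, one_mul, zero_mul, Finset.sum_ite_eq, Finset.mem_univ, if_true]
  congr 1
  exact (Fin.cons_self_tail w).symm

lemma HLsub_eq_range {g k : ℕ} {a : Perm (Fin (k+1)) → ℚ}
    (h : Lsub g k = LinearMap.range (op (g := g) a)) :
    HLsub g k = LinearMap.range (op (g := g) (liftCoeff a)) := by
  refine le_antisymm (Submodule.span_le.2 ?_) ?_
  · rintro _ ⟨u, ξ, hξ, rfl⟩
    rw [h] at hξ
    obtain ⟨s, rfl⟩ := hξ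
    exact ⟨oneTmul u s, op_liftCoeff_oneTmul a u s⟩
  · rintro _ ⟨t, rfl⟩
    rw [sum_oneTmul t, map_sum]
    refine Submodule.sum_mem _ fun x _ => Submodule.subset_span ?_
    refine ⟨_, _, ?_, op_liftCoeff_oneTmul a _ _⟩
    rw [h]
    exact ⟨_, rfl⟩

/-- the coefficients of the bracket map -/
def betaCoeff (n : ℕ) : Perm (Fin (n+1)) → ℚ :=
  fun σ => (if σ = 1 then 1 else 0) - if σ = (finRotate (n+1))⁻¹ then 1 else 0

lemma finRotate_inv_eq (n : ℕ) (i : Fin (n+1)) :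
    ((finRotate (n+1))⁻¹ : Perm (Fin (n+1))) i = Fin.cases (Fin.last n) (fun j => j.castSucc) i := by
  rw [Equiv.Perm.inv_eq_iff_eq]
  induction i using Fin.cases with
  | zero => simp
  | succ j => simp

lemma betaFun_eq {g n : ℕ} (t : Tens g (n+1)) (w : Fin (n+1) → Fin (2*g)) :
    betaFun t w = t w - t (w ∘ ((finRotate (n+1))⁻¹ : Perm (Fin (n+1)))) := by
  rw [betaFun]
  congr 2
  funext i
  rw [Function.comp_apply, finRotate_inv_eq]
  induction i using Fin.cases <;> rfl

lemma betaL_eq_op (g n : ℕ) : betaL g n = op (betaCoeff n) := by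
  refine LinearMap.ext fun t => funext fun w => ?_
  change betaFun t w = _
  rw [betaFun_eq, op_apply]
  simp only [betaCoeff, sub_mul, ite_mul, one_mul, zero_mul, Finset.sum_sub_distrib,
    Finset.sum_ite_eq', Finset.mem_univ, if_true]
  rfl

/-- the bracket `[u, ·]` as a linear map -/
def brktL {g : ℕ} (m : ℕ) (u : HH g) : Tens g m →ₗ[ℚ] Tens g (m+1) where
  toFun := oneBrkt u
  map_add' a b := by funext w; simp only [oneBrkt, Pi.add_apply]; ring
  map_smul' c a := by
    funext w; simp only [oneBrkt, Pi.smul_apply, smul_eq_mul, RingHom.id_apply]; ring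

lemma betaFun_oneTmul {g m : ℕ} (u : HH g) (ξ : Tens g m) :
    betaFun (oneTmul u ξ) = oneBrkt u ξ := by
  funext w
  simp only [betaFun, oneTmul, oneBrkt, Fin.cases_zero, Fin.cases_succ]
  ring

lemma oneBrkt_mem_Lsub {g m : ℕ} (u : HH g) {ξ : Tens g (m+1)} (hξ : ξ ∈ Lsub g m) :
    oneBrkt u ξ ∈ Lsub g (m+1) := by
  have : Lsub g m ≤ (Lsub g (m+1)).comap (brktL (m+1) u) := by
    refine Submodule.span_le.2 ?_
    rintro _ ⟨v, rfl⟩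
    exact Submodule.subset_span ⟨Fin.cons u v, by simp [leftNormed, brktL]⟩
  exact this hξ

lemma Lsub_succ (g m : ℕ) : Lsub g (m+1) = (HLsub g m).map (betaL g (m+1)) := by
  refine le_antisymm (Submodule.span_le.2 ?_) ?_
  · rintro _ ⟨u, rfl⟩
    refine ⟨oneTmul (u 0) (leftNormed g m fun i => u i.succ),
      Submodule.subset_span ⟨_, _, Submodule.subset_span ⟨_, rfl⟩, rfl⟩, ?_⟩
    exact betaFun_oneTmul _ _
  · rw [HLsub, Submodule.map_span, Submodule.span_le]
    rintro _ ⟨_, ⟨u, ξ, hξ, rfl⟩, rfl⟩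
    have := oneBrkt_mem_Lsub u hξ
    rwa [← betaFun_oneTmul] at this

lemma Lsub_zero (g : ℕ) : Lsub g 0 = ⊤ := by
  refine eq_top_iff.2 fun t _ => Submodule.subset_span ⟨fun _ a => t fun _ => a, ?_⟩
  funext w
  simp only [leftNormed]
  congr 1
  funext i
  exact congrArg w (Fin.fin_one_eq_zero i).symm

lemma exists_Lsub_eq_range : ∀ m : ℕ, ∃ a : Perm (Fin (m+1)) → ℚ,
    ∀ g, Lsub g m = LinearMap.range (op (g := g) a)
  | 0 => by
      refine ⟨fun σ => if σ = 1 then 1 else 0, fun g => ?_⟩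
      rw [Lsub_zero, eq_comm, LinearMap.range_eq_top]
      intro t
      refine ⟨t, funext fun w => ?_⟩
      simp [op_apply]
  | m+1 => by
      obtain ⟨a, ha⟩ := exists_Lsub_eq_range m
      refine ⟨fun ρ => ∑ σ, betaCoeff (m+1) σ * liftCoeff a (σ⁻¹ * ρ), fun g => ?_⟩
      rw [Lsub_succ, HLsub_eq_range (ha g), betaL_eq_op, ← LinearMap.range_comp]
      congr 1
      exact LinearMap.ext fun t => op_op _ _ t

lemma exists_HLsub_eq_range (k : ℕ) : ∃ a : Perm (Fin (k+2)) → ℚ,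
    ∀ g, HLsub g k = LinearMap.range (op (g := g) a) := by
  obtain ⟨a, ha⟩ := exists_Lsub_eq_range k
  exact ⟨liftCoeff a, fun g => HLsub_eq_range (ha g)⟩

/-- Pulling back along a symplectic embedding of letters maps `h_{g',1}(k)^{Sp}` onto
`h_{g,1}(k)^{Sp}`. -/
lemma map_pullback_hSp {g g' : ℕ} {s : Fin (2*g) → Fin (2*g')} (hs : PreservesOmega s) (k : ℕ) :
    (hSp g' k).map (pullback (k+2) s) = hSp g k := by
  obtain ⟨b, hb⟩ := exists_HLsub_eq_range k
  apply le_antisymm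
  · rintro _ ⟨T, ⟨⟨hT1, hT2⟩, hT3⟩, rfl⟩
    refine ⟨⟨?_, ?_⟩, ?_⟩
    · rw [SetLike.mem_coe, hb] at hT1 ⊢
      obtain ⟨S, rfl⟩ := hT1
      exact ⟨pullback _ s S, op_pullback s b S⟩
    · rw [SetLike.mem_coe, LinearMap.mem_ker, betaL_eq_op] at hT2 ⊢
      rw [op_pullback, hT2, map_zero]
    · rw [SetLike.mem_coe, spInv_eq_chordSpan] at hT3 ⊢
      rw [← map_pullback_chordSpan hs]
      exact Submodule.mem_map_of_mem hT3
  · rintro t ⟨⟨h1, h2⟩, h3⟩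
    rw [SetLike.mem_coe, hb] at h1
    rw [SetLike.mem_coe, LinearMap.mem_ker, betaL_eq_op] at h2
    obtain ⟨r, hr, rfl⟩ := exists_mem_spInv_op_eq b h3 h1
    rw [op_op] at h2
    obtain ⟨T, hT, rfl, h⟩ := exists_lift_ker_op hs _ hr h2
    refine ⟨op b T, ⟨⟨?_, ?_⟩, op_mem_spInv b hT⟩, (op_pullback s b T).symm⟩
    · rw [SetLike.mem_coe, hb]
      exact ⟨T, rfl⟩
    · rw [SetLike.mem_coe, LinearMap.mem_ker, betaL_eq_op, op_op, h]

/-! ## Functions on permutations with exchange relations -/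

section Exchange

open Equiv

variable {α : Type*} [Fintype α] [DecidableEq α]

/-- the permutations fixing every point of `F` -/
def fixer (F : Finset α) : Finset (Perm α) := {κ | ∀ x ∈ F, κ x = x}

lemma mem_fixer {F : Finset α} {κ : Perm α} : κ ∈ fixer F ↔ ∀ x ∈ F, κ x = x := by
  simp [fixer]

lemma mul_mem_fixer {F : Finset α} {κ τ : Perm α} (h : κ ∈ fixer F) (h' : τ ∈ fixer F) :
    κ * τ ∈ fixer F := by
  rw [mem_fixer] at *
  intro x hx
  rw [Perm.mul_apply, h' x hx, h x hx]

lemma inv_mem_fixer {F : Finset α} {κ : Perm α} (h : κ ∈ fixer F) : κ⁻¹ ∈ fixer F := by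
  rw [mem_fixer] at *
  intro x hx
  rw [Perm.inv_eq_iff_eq, h x hx]

lemma apply_notMem_of_mem_fixer {F : Finset α} {κ : Perm α} (h : κ ∈ fixer F) {x : α}
    (hx : x ∉ F) : κ x ∉ F := by
  intro hk
  have h1 := mem_fixer.1 h _ hk
  exact hx (κ.injective h1 ▸ hk)

lemma sum_fixer_mul_right {F : Finset α} {τ : Perm α} (h : τ ∈ fixer F) (X : Perm α → ℚ) :
    ∑ κ ∈ fixer F, X (κ * τ) = ∑ κ ∈ fixer F, X κ := by
  refine Finset.sum_nbij' (fun κ => κ * τ) (fun κ => κ * τ⁻¹) ?_ ?_ ?_ ?_ ?_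
  · exact fun κ hκ => mul_mem_fixer hκ h
  · exact fun κ hκ => mul_mem_fixer hκ (inv_mem_fixer h)
  · intro κ _; simp
  · intro κ _; simp
  · intro κ _; rfl

lemma sum_fixer_mul_left {F : Finset α} {τ : Perm α} (h : τ ∈ fixer F) (X : Perm α → ℚ) :
    ∑ κ ∈ fixer F, X (τ * κ) = ∑ κ ∈ fixer F, X κ := by
  refine Finset.sum_nbij' (fun κ => τ * κ) (fun κ => τ⁻¹ * κ) ?_ ?_ ?_ ?_ ?_
  · exact fun κ hκ => mul_mem_fixer h hκ
  · exact fun κ hκ => mul_mem_fixer (inv_mem_fixer h) hκ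
  · intro κ _; simp
  · intro κ _; simp
  · intro κ _; rfl

/-- A function satisfying the exchange relations for `c, d` and the symmetry under the stabilizer
of `F ∪ {d}` is determined by its averages over the stabilizer of `F`. -/
lemma eq_zero_of_sum_fixer_eq_zero {F : Finset α} {c d : α} (hc : c ∈ F) (hd : d ∉ F)
    {X : Perm α → ℚ} (hinv : ∀ τ ∈ fixer (insert d F), ∀ σ, X (τ * σ) = X σ)
    (hswap : ∀ σ, X (swap c d * σ) = - X σ)
    (hex : ∀ e, e ∉ F → e ≠ d → ∀ σ, X σ = X (swap e c * σ) + X (swap e d * σ))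
    (hsum : ∀ σ, ∑ κ ∈ fixer F, X (κ * σ) = 0) (σ : Perm α) : X σ = 0 := by
  have key : ∀ κ ∈ fixer F, X (κ * σ) - X (κ * (swap c d * σ))
      = (if κ d = d then 2 else 1) * X σ := by
    intro κ hκ
    by_cases hkd : κ d = d
    · have hk : κ ∈ fixer (insert d F) := by
        rw [mem_fixer] at hκ ⊢
        intro x hx
        rcases Finset.mem_insert.1 hx with rfl | hx
        exacts [hkd, hκ x hx]
      rw [if_pos hkd, hinv κ hk, hinv κ hk, hswap]
      ring
    · rw [if_neg hkd, one_mul]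
      obtain ⟨e, he⟩ : ∃ e, κ e = d := ⟨κ⁻¹ d, by rw [← Perm.mul_apply, mul_inv_cancel]; rfl⟩
      have heF : e ∉ F := fun h => hd (by rwa [← he, mem_fixer.1 hκ e h])
      have hed : e ≠ d := by rintro rfl; exact hkd he
      have hec : e ≠ c := by rintro rfl; exact heF hc
      have hdc : d ≠ c := by rintro rfl; exact hd hc
      have hk : κ * swap e d ∈ fixer (insert d F) := by
        rw [mem_fixer] at hκ ⊢
        intro x hx
        rcases Finset.mem_insert.1 hx with rfl | hx
        · rw [Perm.mul_apply, swap_apply_right, he]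
        · rw [Perm.mul_apply, swap_apply_of_ne_of_ne, hκ x hx]
          · rintro rfl; exact heF hx
          · intro hxd; exact hd (hxd ▸ hx)
      have h1 : ∀ ρ, X (κ * ρ) = X (swap e d * ρ) := by
        intro ρ
        rw [← hinv _ hk (swap e d * ρ), mul_assoc, swap_mul_self_mul]
      rw [h1, h1, hex e heF hed σ]
      have h2 : swap e d * (swap c d * σ) = swap c d * (swap e c * σ) := by
        rw [← mul_assoc, ← mul_assoc, mul_swap_eq_swap_mul (swap c d) e c, swap_apply_left,
          swap_apply_of_ne_of_ne hec hed]
      rw [h2, hswap]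
      ring
  have h1 : (∑ κ ∈ fixer F, (if κ d = d then (2:ℚ) else 1)) * X σ = 0 := by
    rw [Finset.sum_mul, ← Finset.sum_congr rfl key, Finset.sum_sub_distrib, hsum, hsum, sub_zero]
  refine (mul_eq_zero.1 h1).resolve_left (ne_of_gt ?_)
  refine Finset.sum_pos (fun κ _ => by split_ifs <;> norm_num) ⟨1, ?_⟩
  simp [mem_fixer]

lemma invariant_of_swap {F : Finset α} {X : Perm α → ℚ}
    (h : ∀ e f, e ∉ F → f ∉ F → e ≠ f → ∀ σ, X (swap e f * σ) = X σ) :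
    ∀ τ ∈ fixer F, ∀ σ, X (τ * σ) = X σ := by
  have main : ∀ ρ : Perm {x // x ∉ F}, ∀ σ, X (Perm.ofSubtype ρ * σ) = X σ := by
    intro ρ
    induction ρ using Perm.swap_induction_on with
    | one => simp
    | swap_mul f x y hxy ih =>
      intro σ
      rw [map_mul, Perm.ofSubtype_swap_eq, mul_assoc,
        h _ _ x.2 y.2 (fun e => hxy (Subtype.ext e)), ih]
  intro τ hτ σ
  have h1 : ∀ x, x ∉ F ↔ τ x ∉ F := fun x =>
    ⟨apply_notMem_of_mem_fixer hτ, fun hx hx' => hx (by rwa [mem_fixer.1 hτ x hx'])⟩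
  have h2 := Perm.ofSubtype_subtypePerm (f := τ) (p := fun x => x ∉ F) (fun x => (h1 x).symm)
    (fun x hx hxF => hx (mem_fixer.1 hτ x hxF))
  rw [← h2, main]

/-- the exchange relations for a function supported on words in which exactly two letters
occur twice, at places `a, b` and `c, d` respectively -/
structure Exchange (a b c d : α) (G : Perm α → ℚ) : Prop where
  ab : ∀ σ, G (swap a b * σ) = - G σ
  cd : ∀ σ, G (swap c d * σ) = - G σ
  ef : ∀ e f, e ∉ ({a, b, c, d} : Finset α) → f ∉ ({a, b, c, d} : Finset α) → e ≠ f →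
    ∀ σ, G (swap e f * σ) = G σ
  c : ∀ e, e ≠ c → e ≠ d → ∀ σ, G σ = G (swap e c * σ) + G (swap e d * σ)
  a : ∀ e, e ≠ a → e ≠ b → ∀ σ, G σ = G (swap e a * σ) + G (swap e b * σ)

lemma Exchange.swap_swap {a b c d : α} {G : Perm α → ℚ} (h : Exchange a b c d G)
    (hab : a ≠ b) (hac : a ≠ c) (had : a ≠ d) (hbd : b ≠ d) (σ : Perm α) :
    G (swap a c * (swap b d * σ)) = G σ := by
  have h1 := h.c a hac had (swap b d * σ)
  have h2 : swap a d * (swap b d * σ) = swap a b * (swap a d * σ) := by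
    rw [← mul_assoc, ← mul_assoc, mul_swap_eq_swap_mul (swap a d) b d, swap_apply_right,
      swap_apply_of_ne_of_ne hab.symm hbd, swap_comm b a]
  have h3 := h.a d had.symm hbd.symm σ
  rw [h2, h.ab] at h1
  rw [swap_comm d a, swap_comm d b] at h3
  linarith

lemma Exchange.eq_zero {a b c d : α} {G : Perm α → ℚ} (h : Exchange a b c d G)
    (hab : a ≠ b) (had : a ≠ d) (hbc : b ≠ c) (hbd : b ≠ d) (hcd : c ≠ d)
    (hsum : ∀ σ, ∑ κ ∈ fixer {a, c}, G (κ * σ) = 0) (σ : Perm α) : G σ = 0 := by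
  have hset : ({a, b, c, d} : Finset α) = insert b {d, a, c} := by ext x; simp; tauto
  have hinv := invariant_of_swap h.ef
  rw [hset] at hinv
  have hG : ∀ σ, ∑ κ ∈ fixer {d, a, c}, G (κ * σ) = 0 := by
    intro σ
    have hcomm : ∀ τ ∈ fixer {d, a, c}, ∀ e f σ,
        G (τ * (swap e f * σ)) = G (swap (τ e) (τ f) * (τ * σ)) := by
      intro τ _ e f σ
      rw [← mul_assoc, ← mul_assoc, mul_swap_eq_swap_mul]
    refine eq_zero_of_sum_fixer_eq_zero (F := {a, c}) (c := c) (d := d)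
      (X := fun σ => ∑ κ ∈ fixer {d, a, c}, G (κ * σ)) (by simp) (by simp [had.symm, hcd.symm])
      ?_ ?_ ?_ ?_ σ
    · intro τ hτ σ
      have := sum_fixer_mul_right hτ (fun κ => G (κ * σ))
      simpa only [mul_assoc] using this
    · intro σ
      rw [← Finset.sum_neg_distrib]
      refine Finset.sum_congr rfl fun τ hτ => ?_
      rw [hcomm τ hτ, mem_fixer.1 hτ c (by simp), mem_fixer.1 hτ d (by simp), h.cd]
    · intro e he hed σ
      have he' : e ∉ ({d, a, c} : Finset α) := by
        simp only [Finset.mem_insert, Finset.mem_singleton] at he ⊢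
        tauto
      rw [← Finset.sum_add_distrib]
      refine Finset.sum_congr rfl fun τ hτ => ?_
      have h1 := apply_notMem_of_mem_fixer hτ he'
      simp only [Finset.mem_insert, Finset.mem_singleton, not_or] at h1
      rw [hcomm τ hτ, hcomm τ hτ, mem_fixer.1 hτ c (by simp), mem_fixer.1 hτ d (by simp)]
      exact h.c _ h1.2.2 h1.1 _
    · intro σ
      rw [Finset.sum_comm]
      refine Finset.sum_eq_zero fun τ hτ => ?_
      have hτ' : τ ∈ fixer {a, c} := by
        rw [mem_fixer] at hτ ⊢
        exact fun x hx => hτ x (Finset.mem_insert_of_mem hx)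
      have := sum_fixer_mul_left hτ' (fun κ => G (κ * σ))
      rw [hsum] at this
      simpa only [mul_assoc] using this
  refine eq_zero_of_sum_fixer_eq_zero (F := {d, a, c}) (c := a) (d := b) (by simp)
    (by simp [hab.symm, hbc, hbd]) hinv h.ab ?_ hG σ
  intro e he heb
  simp only [Finset.mem_insert, Finset.mem_singleton, not_or] at he
  exact h.a e he.2.1 heb

/-- the partial averages of `G` -/
def avg (a c : α) (G : Perm α → ℚ) (x y : α) : ℚ :=
  ∑ σ : Perm α, if σ x = a ∧ σ y = c then G σ else 0

lemma avg_inv (a c : α) (G : Perm α → ℚ) (π : Perm α) (x y : α) :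
    avg a c G (π⁻¹ x) (π⁻¹ y) = avg a c (fun σ => G (σ * π)) x y := by
  unfold avg
  rw [← Equiv.sum_comp (Equiv.mulRight π)]
  refine Finset.sum_congr rfl fun σ _ => ?_
  simp only [Equiv.coe_mulRight, Perm.mul_apply, ← Perm.mul_apply π, mul_inv_cancel,
    Perm.one_apply]

lemma avg_self {a c : α} (h : a ≠ c) (G : Perm α → ℚ) (x : α) : avg a c G x x = 0 :=
  Finset.sum_eq_zero fun _ _ => if_neg fun ⟨h1, h2⟩ => h (h1.symm.trans h2)

lemma Exchange.avg_comm {a b c d : α} {G : Perm α → ℚ} (h : Exchange a b c d G)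
    (hab : a ≠ b) (hac : a ≠ c) (had : a ≠ d) (hbc : b ≠ c) (hbd : b ≠ d) (hcd : c ≠ d)
    (x y : α) : avg a c G x y = avg a c G y x := by
  unfold avg
  rw [← Equiv.sum_comp (Equiv.mulLeft (swap a c * swap b d))]
  refine Finset.sum_congr rfl fun σ _ => ?_
  simp only [Equiv.coe_mulLeft, mul_assoc]
  rw [h.swap_swap hab hac had hbd]
  refine if_congr ?_ rfl rfl
  simp only [Perm.mul_apply]
  rw [swap_apply_eq_iff, swap_apply_eq_iff, swap_apply_eq_iff, swap_apply_eq_iff,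
    swap_apply_left, swap_apply_right, swap_apply_of_ne_of_ne hbc.symm hcd,
    swap_apply_of_ne_of_ne hab had, and_comm]

lemma sum_fixer_eq_avg (a c : α) (G : Perm α → ℚ) (σ : Perm α) :
    ∑ κ ∈ fixer {a, c}, G (κ * σ) = avg a c G (σ⁻¹ a) (σ⁻¹ c) := by
  rw [avg_inv, avg, ← Finset.sum_filter]
  refine Finset.sum_congr ?_ fun _ _ => rfl
  ext κ
  simp [mem_fixer]

end Exchange

/-! ## Reversal and shuffle relations for Lie elements -/

lemma leftNormed_rev {g : ℕ} : ∀ (m : ℕ) (u : Fin (m+1) → HH g) (w : Fin (m+1) → Fin (2*g)),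
    leftNormed g m u (w ∘ Fin.rev) = (-1)^m * leftNormed g m u w
  | 0, u, w => by simp [leftNormed]
  | m+1, u, w => by
      have h1 := leftNormed_rev m (fun i => u i.succ) (fun i => w i.castSucc)
      have h2 := leftNormed_rev m (fun i => u i.succ) (fun i => w i.succ)
      simp only [leftNormed, oneBrkt, Function.comp_apply, Fin.rev_succ, Fin.rev_castSucc,
        Fin.rev_zero, Fin.rev_last]
      simp only [Function.comp_def] at h1 h2
      rw [h1, h2]
      ring

lemma Lsub_rev {g m : ℕ} {ξ : Tens g (m+1)} (h : ξ ∈ Lsub g m) (w : Fin (m+1) → Fin (2*g)) :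
    ξ (w ∘ Fin.rev) = (-1)^m * ξ w := by
  induction h using Submodule.span_induction with
  | mem x hx => obtain ⟨u, rfl⟩ := hx; exact leftNormed_rev m u w
  | zero => simp
  | add x y _ _ hx hy => simp only [Pi.add_apply, hx, hy, mul_add]
  | smul c x _ hx => simp only [Pi.smul_apply, smul_eq_mul, hx]; ring

lemma insertNth_castSucc_castSucc {β : Type*} {n : ℕ} (j : Fin (n+1)) (a : β)
    (v : Fin (n+1) → β) :
    (fun i : Fin (n+1) => Fin.insertNth (α := fun _ => β) j.castSucc a v i.castSucc)
      = Fin.insertNth (α := fun _ => β) j a (fun i => v i.castSucc) := by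
  rw [Fin.eq_insertNth_iff]
  refine ⟨by simp, ?_⟩
  funext i
  simp only [Fin.removeNth]
  rw [← Fin.castSucc_succAbove_castSucc, Fin.insertNth_apply_succAbove]

lemma insertNth_succ_succ {β : Type*} {n : ℕ} (j : Fin (n+1)) (a : β) (v : Fin (n+1) → β) :
    (fun i : Fin (n+1) => Fin.insertNth (α := fun _ => β) j.succ a v i.succ)
      = Fin.insertNth (α := fun _ => β) j a (fun i => v i.succ) := by
  rw [Fin.eq_insertNth_iff]
  refine ⟨by simp, ?_⟩
  funext i
  simp only [Fin.removeNth]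
  rw [← Fin.succ_succAbove_succ, Fin.insertNth_apply_succAbove]

lemma sum_oneBrkt_insertNth {g m : ℕ} (u : HH g) {ξ : Tens g (m+1)}
    (h : ∀ a v, ∑ j : Fin (m+1), ξ (Fin.insertNth (α := fun _ => Fin (2*g)) j a v) = 0)
    (a : Fin (2*g)) (v : Fin (m+1) → Fin (2*g)) :
    ∑ j : Fin (m+2), oneBrkt u ξ (Fin.insertNth (α := fun _ => Fin (2*g)) j a v) = 0 := by
  simp only [oneBrkt, Finset.sum_sub_distrib]
  rw [Fin.sum_univ_succ, Fin.sum_univ_castSucc (n := m+1) (f := fun j : Fin (m+2) =>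
    ξ (fun i => Fin.insertNth (α := fun _ => Fin (2*g)) j a v i.castSucc)
      * u (Fin.insertNth (α := fun _ => Fin (2*g)) j a v (Fin.last (m+1))))]
  have h1 : ∀ j : Fin (m+1),
      Fin.insertNth (α := fun _ => Fin (2*g)) j.castSucc a v (Fin.last (m+1)) = v (Fin.last m) := by
    intro j
    have := Fin.insertNth_apply_succAbove (α := fun _ => Fin (2*g)) j.castSucc a v (Fin.last m)
    rwa [Fin.succAbove_castSucc_of_le _ _ (Fin.le_last _)] at this
  have h2 : ∀ j : Fin (m+1),
      Fin.insertNth (α := fun _ => Fin (2*g)) j.succ a v 0 = v 0 := by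
    intro j
    have := Fin.insertNth_apply_succAbove (α := fun _ => Fin (2*g)) j.succ a v 0
    rwa [Fin.succ_succAbove_zero] at this
  simp only [h1, h2, insertNth_castSucc_castSucc, insertNth_succ_succ, ← Finset.mul_sum,
    ← Finset.sum_mul, h]
  simp [Fin.insertNth_zero', Fin.insertNth_last', mul_comm]

lemma sum_leftNormed_insertNth {g : ℕ} : ∀ (m : ℕ) (u : Fin (m+2) → HH g) (a : Fin (2*g))
    (v : Fin (m+1) → Fin (2*g)),
    ∑ j : Fin (m+2), leftNormed g (m+1) u (Fin.insertNth (α := fun _ => Fin (2*g)) j a v) = 0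
  | 0, u, a, v => by
      refine (Fin.sum_univ_two _).trans ?_
      change u 0 a * u 1 (v 0) - u 1 a * u 0 (v 0) + (u 0 (v 0) * u 1 a - u 1 (v 0) * u 0 a) = 0
      ring
  | m+1, u, a, v => by
      exact sum_oneBrkt_insertNth (u 0) (sum_leftNormed_insertNth m fun i => u i.succ) a v

lemma sum_Lsub_insertNth {g m : ℕ} {ξ : Tens g (m+2)} (h : ξ ∈ Lsub g (m+1)) (a : Fin (2*g))
    (v : Fin (m+1) → Fin (2*g)) :
    ∑ j : Fin (m+2), ξ (Fin.insertNth (α := fun _ => Fin (2*g)) j a v) = 0 := by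
  induction h using Submodule.span_induction with
  | mem x hx => obtain ⟨u, rfl⟩ := hx; exact sum_leftNormed_insertNth m u a v
  | zero => simp
  | add x y _ _ hx hy => simp only [Pi.add_apply, Finset.sum_add_distrib, hx, hy, add_zero]
  | smul c x _ hx => simp only [Pi.smul_apply, ← Finset.smul_sum, hx, smul_zero]

lemma comp_liftPerm_succ {β : Type*} {n : ℕ} (w : Fin (n+1) → β) (σ : Perm (Fin n)) :
    (fun i : Fin n => (w ∘ liftPerm σ) i.succ) = (fun i => w i.succ) ∘ σ := by
  funext i; simp

lemma HLsub_rev {g k : ℕ} {t : Tens g (k+2)} (h : t ∈ HLsub g k) (w : Fin (k+2) → Fin (2*g)) :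
    t (w ∘ liftPerm Fin.revPerm) = (-1)^k * t w := by
  induction h using Submodule.span_induction with
  | mem x hx =>
    obtain ⟨u, ξ, hξ, rfl⟩ := hx
    simp only [oneTmul]
    rw [comp_liftPerm_succ, Function.comp_apply, liftPerm_zero]
    have := Lsub_rev hξ (fun i => w i.succ)
    rw [show (⇑(Fin.revPerm : Perm (Fin (k+1)))) = Fin.rev from rfl, this]
    ring
  | zero => simp
  | add x y _ _ hx hy => simp only [Pi.add_apply, hx, hy, mul_add]
  | smul c x _ hx => simp only [Pi.smul_apply, smul_eq_mul, hx]; ring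

lemma sum_HLsub_cycleRange {g k : ℕ} {t : Tens g (k+3)} (h : t ∈ HLsub g (k+1))
    (w : Fin (k+3) → Fin (2*g)) :
    ∑ j : Fin (k+2), t (w ∘ liftPerm (Fin.cycleRange j)) = 0 := by
  induction h using Submodule.span_induction with
  | mem x hx =>
    obtain ⟨u, ξ, hξ, rfl⟩ := hx
    simp only [oneTmul, comp_liftPerm_succ]
    simp only [Function.comp_apply, liftPerm_zero]
    rw [← Finset.mul_sum]
    have h1 : (fun i : Fin (k+2) => w i.succ)
        = Fin.cons (α := fun _ => Fin (2*g)) (w 1) (fun i => w i.succ.succ) := by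
      funext i
      induction i using Fin.cases <;> rfl
    rw [h1]
    simp only [Fin.cons_comp_cycleRange]
    rw [sum_Lsub_insertNth hξ, mul_zero]
  | zero => simp
  | add x y _ _ hx hy => simp only [Pi.add_apply, Finset.sum_add_distrib, hx, hy, add_zero]
  | smul c x _ hx => simp only [Pi.smul_apply, ← Finset.smul_sum, hx, smul_zero]

lemma revPerm_succ (n : ℕ) :
    (Fin.revPerm : Perm (Fin (n+1))) = (finRotate (n+1))⁻¹ * liftPerm Fin.revPerm := by
  ext i
  rw [Equiv.Perm.mul_apply, finRotate_inv_eq]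
  induction i using Fin.cases <;> simp

lemma sign_revPerm_succ (n : ℕ) :
    Equiv.Perm.sign (Fin.revPerm : Perm (Fin (n+1)))
      = (-1)^n * Equiv.Perm.sign (Fin.revPerm : Perm (Fin n)) := by
  rw [revPerm_succ, map_mul, Equiv.Perm.sign_inv, sign_finRotate, sign_liftPerm]
  rfl

lemma sign_revPerm : ∀ m : ℕ, Equiv.Perm.sign (Fin.revPerm : Perm (Fin (4*m+1))) = 1
  | 0 => by decide
  | m+1 => by
      have h := sign_revPerm m
      rw [show 4*(m+1)+1 = 4*m+1+1+1+1+1 by ring]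
      rw [sign_revPerm_succ, sign_revPerm_succ, sign_revPerm_succ, sign_revPerm_succ, h]
      have h1 : ((-1 : ℤˣ))^(4*m) = 1 := by rw [pow_mul]; norm_num
      simp only [pow_add, h1]
      norm_num

/-! ## Vanishing of the averages -/

lemma inv_liftPerm_zero {n : ℕ} (σ : Perm (Fin n)) : (liftPerm σ)⁻¹ 0 = 0 := by
  rw [Equiv.Perm.inv_eq_iff_eq, liftPerm_zero]

lemma inv_liftPerm_succ {n : ℕ} (σ : Perm (Fin n)) (i : Fin n) :
    (liftPerm σ)⁻¹ i.succ = (σ⁻¹ i).succ := by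
  rw [Equiv.Perm.inv_eq_iff_eq, liftPerm_succ, ← Equiv.Perm.mul_apply, mul_inv_cancel,
    Equiv.Perm.one_apply]

lemma sum_alternating_ite (m : ℕ) (A B : ℚ) : ∀ n : ℕ,
    ∑ j ∈ Finset.range (2*n+1), (-1:ℚ)^j * (if 2*m < j then A else B) = B
  | 0 => by simp
  | n+1 => by
      rw [show 2*(n+1)+1 = 2*n+1+1+1 by ring, Finset.sum_range_succ, Finset.sum_range_succ,
        sum_alternating_ite m A B n]
      have h : (-1:ℚ)^(2*n) = 1 := by rw [pow_mul]; norm_num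
      have h2 : 2*m < 2*n+1+1 ↔ 2*m < 2*n+1 := by omega
      simp only [h2, pow_add, h]
      ring

lemma avg_eq_zero {k : ℕ} {a c : Fin (2*k+2)} (hac : a ≠ c) {G : Perm (Fin (2*k+2)) → ℚ}
    (hcomm : ∀ x y, avg a c G x y = avg a c G y x)
    (hrot : ∀ σ, G (σ * (finRotate (2*k+2))⁻¹) = - G σ)
    (hrev : ∀ σ, G (σ * liftPerm Fin.revPerm) = G σ)
    (hsh : ∀ σ, ∑ j : Fin (2*k+1), (-1)^j.val * G (σ * liftPerm (Fin.cycleRange j)) = 0)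
    (x y : Fin (2*k+2)) : avg a c G x y = 0 := by
  have hneg : ∀ x y, avg a c (fun σ => - G σ) x y = - avg a c G x y := by
    intro x y
    simp only [avg, ← Finset.sum_neg_distrib]
    exact Finset.sum_congr rfl fun σ _ => by split_ifs <;> simp
  have hstep : ∀ x y, avg a c G (x+1) (y+1) = - avg a c G x y := by
    intro x y
    have := avg_inv a c G ((finRotate (2*k+2))⁻¹) x y
    simp only [hrot, hneg, inv_inv] at this
    rw [← this, finRotate_apply, finRotate_apply]
  have hshift : ∀ x y : Fin (2*k+2), avg a c G x y = (-1)^x.val * avg a c G 0 (y - x) := by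
    intro x
    induction x using Fin.induction with
    | zero => intro y; simp
    | succ i ih =>
      intro y
      have h := hstep i.castSucc (y - 1)
      rw [sub_add_cancel, Fin.coeSucc_eq_succ, ih, sub_sub, add_comm 1, Fin.coeSucc_eq_succ] at h
      rw [h, Fin.val_succ, Fin.val_castSucc]
      ring
  have hzero : ∀ y, avg a c G 0 y = 0 := by
    intro y
    rcases Nat.even_or_odd y.val with hy | hy
    · by_cases hy0 : y = 0
      · rw [hy0, avg_self hac]
      · obtain ⟨m, hm⟩ := hy
        have hm0 : m ≠ 0 := by
          rintro rfl; exact hy0 (Fin.ext hm)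
        have hylt := y.isLt
        let i : Fin (2*k) := ⟨2*(m-1), by omega⟩
        have hyi : y = i.succ.succ := Fin.ext (by simp [i]; omega)
        let A := avg a c G 0 i.castSucc.succ
        have h1 : ∑ j : Fin (2*k+1), (-1:ℚ)^j.val *
            (if 2*(m-1) < j.val then A else avg a c G 0 y) = 0 := by
          have h2 : ∀ j : Fin (2*k+1), (if 2*(m-1) < j.val then A else avg a c G 0 y)
              = avg a c (fun σ => G (σ * liftPerm (Fin.cycleRange j))) 0 i.succ.succ := by
            intro j
            rw [← avg_inv, inv_liftPerm_zero, inv_liftPerm_succ]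
            have h3 : (Fin.cycleRange j)⁻¹ i.succ = j.succAbove i := Fin.cycleRange_symm_succ j i
            rw [h3]
            split_ifs with h
            · rw [Fin.succAbove_of_castSucc_lt _ _ (by simpa [Fin.lt_def, i] using h)]
            · rw [Fin.succAbove_of_le_castSucc _ _ (by simpa [Fin.le_def, i] using h), ← hyi]
          simp only [h2]
          simp only [avg, Finset.mul_sum]
          rw [Finset.sum_comm]
          refine Finset.sum_eq_zero fun σ _ => ?_
          split_ifs
          · exact hsh σ
          · simp
        rw [Fin.sum_univ_eq_sum_range (fun j => (-1:ℚ)^j *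
            (if 2*(m-1) < j then A else avg a c G 0 y)), sum_alternating_ite] at h1
        exact h1
    · have h1 : avg a c G 0 y = avg a c G 0 (liftPerm Fin.revPerm y) := by
        have := avg_inv a c G (liftPerm Fin.revPerm) 0 (liftPerm Fin.revPerm y)
        simp only [hrev] at this
        rw [inv_liftPerm_zero, ← Equiv.Perm.mul_apply, inv_mul_cancel,
          Equiv.Perm.one_apply] at this
        exact this
      have h2 : liftPerm Fin.revPerm y + y = 0 := by
        induction y using Fin.cases with
        | zero => simp
        | succ i =>
          apply Fin.ext
          rw [liftPerm_succ, Fin.val_add]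
          have : (Fin.revPerm i).succ.val + i.succ.val = 2*k+2 := by
            simp [Fin.val_rev]; omega
          rw [this]
          simp
      have h3 := hshift y 0
      rw [zero_sub, ← eq_neg_of_add_eq_zero_left h2, ← h1, hy.neg_one_pow, hcomm] at h3
      linarith
  rw [hshift, hzero, mul_zero]

/-! ## Invariant tensors supported on words using every letter -/

/-- every word in the support uses all letters -/
def FullSupp {g n : ℕ} (t : Tens g n) : Prop := ∀ w, t w ≠ 0 → Function.Surjective w

lemma FullSupp.perm {g n : ℕ} {t : Tens g n} (h : FullSupp t) (σ : Perm (Fin n)) :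
    FullSupp (fun w => t (w ∘ σ)) :=
  fun w hw => (h (w ∘ σ) hw).of_comp

lemma unitDer_self {g n : ℕ} (a : Fin (2*g)) (t : Tens g n) (w : Fin n → Fin (2*g)) :
    unitDer a a t w = (#{i | w i = a} : ℕ) * t w := by
  rw [unitDer, ← Finset.sum_filter, Finset.sum_congr rfl (g := fun _ => t w)]
  · simp
  · intro i hi
    rw [← (Finset.mem_filter.1 hi).2, Function.update_eq_self]

lemma IsInfInv.card_fiber {g n : ℕ} {t : Tens g n} (ht : IsInfInv t) {w : Fin n → Fin (2*g)}
    (hw : t w ≠ 0) (a : Fin (2*g)) : #{i | w i = a} = #{i | w i = bar a} := by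
  have h := congrFun (ht a a) w
  rw [eps_mul_self, one_smul, unitDer_self, unitDer_self] at h
  exact_mod_cast mul_right_cancel₀ hw h

lemma IsInfInv.unitDer_eq_zero {g n : ℕ} {t : Tens g n} (ht : IsInfInv t) (hs : FullSupp t)
    {p q : Fin (2*g)} {w : Fin n → Fin (2*g)} (hw : q = bar p ∨ ∀ i, w i ≠ p) :
    unitDer q p t w = 0 := by
  have h := congrFun (ht q p) w
  rw [Pi.smul_apply, smul_eq_mul] at h
  by_cases hq : q = bar p
  · subst hq
    rw [bar_bar, eps_bar, neg_mul, eps_mul_self] at h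
    linarith
  · rw [h]
    refine mul_eq_zero_of_right _ (Finset.sum_eq_zero fun i _ => ?_)
    split_ifs
    · by_contra hne
      obtain ⟨j, hj⟩ := hs _ hne p
      by_cases hji : j = i
      · subst hji
        rw [Function.update_self] at hj
        exact hq (by rw [← hj, bar_bar])
      · rw [Function.update_of_ne hji] at hj
        exact hw.resolve_left hq j hj
    · rfl

lemma IsInfInv.exchange {g n : ℕ} {t : Tens g n} (ht : IsInfInv t) (hs : FullSupp t)
    {w : Fin n → Fin (2*g)} {e : Fin n} {q : Fin (2*g)} (hq : q ≠ w e)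
    (hw : q = bar (w e) ∨ ∀ i, w i = w e → i = e) :
    t w + ∑ i with w i = q, t (w ∘ Equiv.swap e i) = 0 := by
  have h : unitDer q (w e) t (Function.update w e q) = 0 := by
    refine ht.unitDer_eq_zero hs (hw.imp_right fun h i hi => ?_)
    by_cases hie : i = e
    · subst hie
      rw [Function.update_self] at hi
      exact hq hi
    · rw [Function.update_of_ne hie] at hi
      exact hie (h i hi)
  rw [unitDer] at h
  rw [← h, Finset.sum_filter, ← Finset.add_sum_erase _ _ (Finset.mem_univ e),
    ← Finset.add_sum_erase (a := e) _ (fun i => ite (Function.update w e q i = q) _ _)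
      (Finset.mem_univ e), if_neg (fun h => hq h.symm), zero_add, Function.update_self, if_pos rfl,
    Function.update_idem, Function.update_eq_self]
  congr 1
  refine Finset.sum_congr rfl fun i hi => ?_
  have hie := Finset.ne_of_mem_erase hi
  rw [Function.update_of_ne hie]
  refine if_ctx_congr Iff.rfl (fun hiq => ?_) fun _ => rfl
  congr 1
  funext j
  rw [Function.comp_apply]
  by_cases hji : j = i
  · rw [hji, Equiv.swap_apply_right, Function.update_self]
  · rw [Function.update_of_ne hji]
    by_cases hje : j = e
    · rw [hje, Equiv.swap_apply_left, Function.update_self, hiq]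
    · rw [Function.update_of_ne hje, Equiv.swap_apply_of_ne_of_ne hje hji]

/-! ## Tensors vanishing on a smaller symplectic space -/

/-- the inclusion of letters -/
def inclLetter (g : ℕ) (a : Fin (2*g)) : Fin (2*(g+1)) := ⟨a, by omega⟩

/-- an embedding of letters avoiding `p` and `bar p` -/
def skipLetter {g : ℕ} (p : Fin (2*(g+1))) (a : Fin (2*g)) : Fin (2*(g+1)) :=
  if a.val / 2 = p.val / 2 then ⟨2*g + a.val % 2, by omega⟩ else ⟨a, by omega⟩

lemma skipLetter_val {g : ℕ} (p : Fin (2*(g+1))) (a : Fin (2*g)) :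
    (skipLetter p a).val = if a.val / 2 = p.val / 2 then 2*g + a.val % 2 else a.val := by
  unfold skipLetter; split_ifs <;> rfl

lemma preservesOmega_of {g g' : ℕ} {s : Fin (2*g) → Fin (2*g')}
    (h : ∀ a b, s b = bar (s a) ↔ b = bar a) (h' : ∀ a, (s a).val % 2 = a.val % 2) :
    PreservesOmega s := by
  intro a b
  rw [omegaB_eq, omegaB_eq]
  refine if_congr (h a b) ?_ rfl
  rw [eps, eps, h']

lemma preservesOmega_inclLetter (g : ℕ) : PreservesOmega (inclLetter g) := by
  refine preservesOmega_of (fun a b => ?_) fun a => rfl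
  rw [Fin.ext_iff, Fin.ext_iff, bar_val, bar_val]
  rfl

lemma preservesOmega_skipLetter {g : ℕ} (p : Fin (2*(g+1))) :
    PreservesOmega (skipLetter (g := g) p) := by
  refine preservesOmega_of (fun a b => ?_) fun a => ?_
  · rw [Fin.ext_iff, Fin.ext_iff, bar_val, bar_val, skipLetter_val, skipLetter_val]
    have := a.isLt
    have := b.isLt
    split_ifs <;> omega
  · rw [skipLetter_val]
    split_ifs <;> omega

lemma exists_skipLetter_eq {g : ℕ} {p x : Fin (2*(g+1))} (h : x ≠ p) (h' : x ≠ bar p) :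
    ∃ a : Fin (2*g), skipLetter p a = x := by
  have hx := x.isLt
  have hp := p.isLt
  rw [Ne, Fin.ext_iff] at h h'
  rw [bar_val] at h'
  have hne : x.val / 2 ≠ p.val / 2 := by
    intro e
    split_ifs at h' <;> omega
  by_cases hg : x.val / 2 = g
  · refine ⟨⟨2*(p.val/2) + x.val % 2, by omega⟩, Fin.ext ?_⟩
    rw [skipLetter_val, if_pos (by simp only; omega)]
    simp only
    omega
  · refine ⟨⟨x.val, by omega⟩, Fin.ext ?_⟩
    rw [skipLetter_val, if_neg hne]

lemma fullSupp_of_pullback_eq_zero {g n : ℕ} {t : Tens (g+1) n} (ht : t ∈ spInv (g+1) n)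
    (h0 : pullback n (inclLetter g) t = 0) : FullSupp t := by
  intro w hw p
  by_contra hp
  have hp1 : ∀ i, w i ≠ p := fun i hi => hp ⟨i, hi⟩
  have hcard := (isInfInv_of_mem_spInv ht).card_fiber hw p
  rw [Finset.card_eq_zero.2 (Finset.filter_eq_empty_iff.2 fun i _ => hp1 i), eq_comm,
    Finset.card_eq_zero, Finset.filter_eq_empty_iff] at hcard
  choose v hv using fun i => exists_skipLetter_eq (hp1 i) (hcard (Finset.mem_univ i))
  rw [spInv_eq_chordSpan] at ht
  have h1 := pullback_congr (preservesOmega_inclLetter g) (preservesOmega_skipLetter p) ht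
  rw [h0] at h1
  have h2 := congrFun h1 v
  rw [pullback_apply, Pi.zero_apply, show skipLetter p ∘ v = w from funext hv] at h2
  exact hw h2.symm

lemma betaL_rotate {g n : ℕ} {t : Tens g (n+1)} (h : betaL g n t = 0) (w : Fin (n+1) → Fin (2*g)) :
    t (w ∘ ((finRotate (n+1))⁻¹ : Perm (Fin (n+1)))) = t w := by
  have h1 : betaFun t w = 0 := congrFun h w
  rw [betaFun_eq, sub_eq_zero] at h1
  exact h1.symm

lemma sign_finRotate_inv (k : ℕ) :
    Equiv.Perm.sign ((finRotate (2*k+2))⁻¹ : Perm (Fin (2*k+2))) = -1 := by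
  rw [Equiv.Perm.sign_inv, sign_finRotate, Nat.add_sub_cancel_right (n := 2*k+1) (m := 1),
    pow_succ, pow_mul]
  norm_num

lemma IsInfInv.sign_of_injective {g n : ℕ} {t : Tens g n} (ht : IsInfInv t) (hs : FullSupp t)
    (σ : Perm (Fin n)) : ∀ {w : Fin n → Fin (2*g)}, Function.Injective w →
      t (w ∘ σ) = (Equiv.Perm.sign σ : ℤ) * t w := by
  induction σ using Equiv.Perm.swap_induction_on with
  | one => intro w _; simp
  | swap_mul f x y hxy ih =>
    intro w hw
    have h1 := ht.exchange hs (w := w) (e := x) (q := w y) (fun h => hxy (hw h).symm)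
      (Or.inr fun i hi => hw hi)
    have h2 : (univ.filter fun i => w i = w y) = {y} := by
      ext i; simp [hw.eq_iff]
    rw [h2, Finset.sum_singleton] at h1
    have h3 := ih (hw.comp (Equiv.swap x y).injective)
    rw [Equiv.Perm.coe_mul, ← Function.comp_assoc, h3, map_mul, Equiv.Perm.sign_swap hxy]
    push_cast
    linear_combination (Equiv.Perm.sign f : ℤ) * h1

lemma hSp_eq_zero_of_le {g k : ℕ} (hg : k ≤ g) {t : Tens (g+1) (2*k+2)}
    (ht : t ∈ hSp (g+1) (2*k)) (h0 : pullback _ (inclLetter g) t = 0) : t = 0 := by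
  obtain ⟨⟨-, hb⟩, hi⟩ := ht
  have hs := fullSupp_of_pullback_eq_zero hi h0
  funext w
  by_contra hw
  have hsurj := hs w hw
  have hcard := Fintype.card_le_of_surjective w hsurj
  simp only [Fintype.card_fin] at hcard
  have hinj : Function.Injective w :=
    ((Fintype.bijective_iff_surjective_and_card w).2
      ⟨hsurj, by simp only [Fintype.card_fin]; omega⟩).1
  have h1 := (isInfInv_of_mem_spInv hi).sign_of_injective hs (finRotate (2*k+2))⁻¹ hinj
  have h2 : t (w ∘ ((finRotate (2*k+2))⁻¹ : Perm (Fin (2*k+2)))) = t w := betaL_rotate hb w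
  rw [sign_finRotate_inv, h2] at h1
  refine hw ?_
  push_cast at h1
  change t w = 0
  linarith

lemma exists_double_pair {k : ℕ} {f : Fin (2*k) → ℕ} (hf : ∀ x, 1 ≤ f x)
    (hbar : ∀ x, f x = f (bar x)) (hsum : ∑ x, f x = 2*k+2) :
    ∃ p, f p = 2 ∧ f (bar p) = 2 ∧ ∀ x, x ≠ p → x ≠ bar p → f x = 1 := by
  obtain ⟨p, hp⟩ : ∃ p, 2 ≤ f p := by
    by_contra! h
    have : ∑ x, f x ≤ ∑ _x : Fin (2*k), 1 := Finset.sum_le_sum fun x _ => by have := h x; omega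
    simp at this
    omega
  have h1 : ∑ x, (f x - 1) = 2 := by
    have : ∑ x, f x = ∑ x, (f x - 1) + ∑ _x : Fin (2*k), 1 := by
      rw [← Finset.sum_add_distrib]
      exact Finset.sum_congr rfl fun x _ => by have := hf x; omega
    simp at this
    omega
  have hne := bar_ne p
  have h2 : ∑ x ∈ {p, bar p}, (f x - 1) ≤ ∑ x, (f x - 1) :=
    Finset.sum_le_sum_of_subset (Finset.subset_univ _)
  rw [Finset.sum_pair hne.symm] at h2
  have h3 := hbar p
  refine ⟨p, by omega, by omega, fun x hxp hxb => ?_⟩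
  have h4 : ∑ x ∈ {x, p, bar p}, (f x - 1) ≤ ∑ x, (f x - 1) :=
    Finset.sum_le_sum_of_subset (Finset.subset_univ _)
  rw [Finset.sum_insert (by simp [hxp, hxb]), Finset.sum_pair hne.symm] at h4
  have := hf x
  omega

/-- the values of `t` on the rearrangements of `w`, with signs -/
def signed {g n : ℕ} (t : Tens g n) (w : Fin n → Fin (2*g)) (σ : Perm (Fin n)) : ℚ :=
  (Equiv.Perm.sign σ : ℤ) * t (w ∘ σ)

lemma signed_swap_of_eq {g n : ℕ} (t : Tens g n) {w : Fin n → Fin (2*g)} {a b : Fin n}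
    (hab : a ≠ b) (h : w a = w b) (σ : Perm (Fin n)) :
    signed t w (Equiv.swap a b * σ) = - signed t w σ := by
  have h1 : w ∘ Equiv.swap a b = w := by
    funext i
    rw [Function.comp_apply, Equiv.swap_apply_def]
    split_ifs with h1 h2
    · rw [h1, h]
    · rw [h2, h]
    · rfl
  rw [signed, signed, Equiv.Perm.coe_mul, ← Function.comp_assoc, h1, map_mul,
    Equiv.Perm.sign_swap hab]
  push_cast
  ring

lemma signed_mul {g n : ℕ} {t : Tens g n} {ρ : Perm (Fin n)} {χ : ℚ}
    (h : ∀ w, t (w ∘ ρ) = χ * t w) (w : Fin n → Fin (2*g)) (σ : Perm (Fin n)) :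
    signed t w (σ * ρ) = (Equiv.Perm.sign ρ : ℤ) * χ * signed t w σ := by
  rw [signed, signed, Equiv.Perm.coe_mul, ← Function.comp_assoc, h, map_mul]
  push_cast
  ring

lemma signed_exchange {g n : ℕ} {t : Tens g n} (ht : IsInfInv t) (hs : FullSupp t)
    {w : Fin n → Fin (2*g)} {e : Fin n} {q : Fin (2*g)} (hq : q ≠ w e)
    (hw : q = bar (w e) ∨ ∀ i, w i = w e → i = e) (σ : Perm (Fin n)) :
    signed t w σ = ∑ i with w i = q, signed t w (Equiv.swap e i * σ) := by
  have h := (ht.perm σ).exchange (hs.perm σ) hq hw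
  have h1 : ∀ i ∈ univ.filter (fun i => w i = q), signed t w (Equiv.swap e i * σ)
      = - ((Equiv.Perm.sign σ : ℤ) * t ((w ∘ Equiv.swap e i) ∘ σ)) := by
    intro i hi
    have hei : e ≠ i := by
      rintro rfl
      exact hq (Finset.mem_filter.1 hi).2.symm
    rw [signed, Equiv.Perm.coe_mul, ← Function.comp_assoc, map_mul, Equiv.Perm.sign_swap hei]
    push_cast
    ring
  rw [Finset.sum_congr rfl h1, Finset.sum_neg_distrib, ← Finset.mul_sum, signed]
  linear_combination (Equiv.Perm.sign σ : ℤ) * h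

lemma exchange_signed {g n : ℕ} {t : Tens g n} (ht : IsInfInv t) (hs : FullSupp t)
    {w : Fin n → Fin (2*g)} {p : Fin (2*g)} {a b c d : Fin n} (hab : a ≠ b) (hcd : c ≠ d)
    (hp : (univ.filter fun i => w i = p) = {a, b})
    (hbp : (univ.filter fun i => w i = bar p) = {c, d})
    (h1 : ∀ x, x ≠ p → x ≠ bar p → #{i | w i = x} = 1) : Exchange a b c d (signed t w) := by
  have hP : ∀ i, w i = p ↔ i = a ∨ i = b := fun i => by
    simpa using Finset.ext_iff.1 hp i
  have hQ : ∀ i, w i = bar p ↔ i = c ∨ i = d := fun i => by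
    simpa using Finset.ext_iff.1 hbp i
  have huniq : ∀ e, w e ≠ p → w e ≠ bar p → ∀ i, w i = w e → i = e := by
    intro e hep heb i hi
    exact Finset.card_le_one.1 (h1 _ hep heb).le i (by simp [hi]) e (by simp)
  refine ⟨signed_swap_of_eq t hab (((hP a).2 (Or.inl rfl)).trans ((hP b).2 (Or.inr rfl)).symm),
    signed_swap_of_eq t hcd (((hQ c).2 (Or.inl rfl)).trans ((hQ d).2 (Or.inr rfl)).symm),
    ?_, ?_, ?_⟩
  · intro e f he hf hef σ
    simp only [Finset.mem_insert, Finset.mem_singleton, not_or] at he hf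
    have he1 : w e ≠ p := fun h => by have := (hP e).1 h; tauto
    have he2 : w e ≠ bar p := fun h => by have := (hQ e).1 h; tauto
    have hf1 : w f ≠ p := fun h => by have := (hP f).1 h; tauto
    have hf2 : w f ≠ bar p := fun h => by have := (hQ f).1 h; tauto
    have hue := huniq e he1 he2
    have huf := huniq f hf1 hf2
    have h2 := signed_exchange ht hs (w := w) (e := e) (q := w f) (fun h => hef (hue f h).symm)
      (Or.inr hue) σ
    have h3 : (univ.filter fun i => w i = w f) = {f} := by
      ext i
      simp only [Finset.mem_filter, Finset.mem_univ, true_and, Finset.mem_singleton]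
      exact ⟨huf i, fun h => h ▸ rfl⟩
    rw [h3, Finset.sum_singleton] at h2
    exact h2.symm
  · intro e hec hed σ
    have heb : w e ≠ bar p := fun h => by have := (hQ e).1 h; tauto
    have h2 := signed_exchange ht hs (w := w) (e := e) (q := bar p) heb.symm
      (by
        by_cases hep : w e = p
        · exact Or.inl (by rw [hep])
        · exact Or.inr (huniq e hep heb)) σ
    rwa [hbp, Finset.sum_pair hcd] at h2
  · intro e hea heb σ
    have hep : w e ≠ p := fun h => by have := (hP e).1 h; tauto
    have h2 := signed_exchange ht hs (w := w) (e := e) (q := p) hep.symm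
      (by
        by_cases hep' : w e = bar p
        · exact Or.inl (by rw [hep', bar_bar])
        · exact Or.inr (huniq e hep hep')) σ
    rwa [hp, Finset.sum_pair hab] at h2

lemma hSp_eq_zero_of_even {g m : ℕ} (hg : g + 1 = 2*m) {t : Tens (g+1) (2*(2*m)+2)}
    (ht : t ∈ hSp (g+1) (2*(2*m))) (h0 : pullback _ (inclLetter g) t = 0) : t = 0 := by
  obtain ⟨⟨hl, hb⟩, hi⟩ := ht
  have hs := fullSupp_of_pullback_eq_zero hi h0
  have hinf := isInfInv_of_mem_spInv hi
  funext w
  by_contra hw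
  obtain ⟨p, hp, hbp, h1⟩ := exists_double_pair (f := fun x => #{i | w i = x})
    (fun x => by
      obtain ⟨i, hi⟩ := hs w hw x
      exact Finset.card_pos.2 ⟨i, by simp [hi]⟩)
    (hinf.card_fiber hw) (by
      have := Finset.card_eq_sum_card_fiberwise (f := w) (s := univ) (t := univ) (by simp)
      rw [← this, Finset.card_univ, Fintype.card_fin, hg])
  obtain ⟨a, b, hab, hP⟩ := Finset.card_eq_two.1 hp
  obtain ⟨c, d, hcd, hQ⟩ := Finset.card_eq_two.1 hbp
  have hE := exchange_signed hinf hs hab hcd hP hQ h1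
  have hne : ∀ x y, x ∈ ({a, b} : Finset _) → y ∈ ({c, d} : Finset _) → x ≠ y := by
    rintro x y hx hy rfl
    rw [← hP] at hx
    rw [← hQ] at hy
    exact bar_ne p ((Finset.mem_filter.1 hy).2.symm.trans (Finset.mem_filter.1 hx).2)
  have hac := hne a c (by simp) (by simp)
  have had := hne a d (by simp) (by simp)
  have hbc := hne b c (by simp) (by simp)
  have hbd := hne b d (by simp) (by simp)
  have havg := avg_eq_zero (k := 2*m) hac (hE.avg_comm hab hac had hbc hbd hcd)
    (fun σ => by
      rw [signed_mul (χ := 1) (fun v => by rw [one_mul]; exact betaL_rotate hb v),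
        sign_finRotate_inv]
      push_cast
      ring)
    (fun σ => by
      rw [signed_mul (χ := 1) (fun v => by
        rw [HLsub_rev hl, pow_mul]
        norm_num), sign_liftPerm]
      have : Equiv.Perm.sign (Fin.revPerm : Perm (Fin (2*(2*m)+1))) = 1 := by
        have := sign_revPerm m
        rwa [show 4*m = 2*(2*m) by ring] at this
      rw [this]
      push_cast
      ring)
    (fun σ => by
      have h2 : ∀ j : Fin (2*(2*m)+1), (-1:ℚ)^j.val * signed t w (σ * liftPerm (Fin.cycleRange j))
          = (Equiv.Perm.sign σ : ℤ) * t ((w ∘ σ) ∘ liftPerm (Fin.cycleRange j)) := by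
        intro j
        rw [signed, map_mul, sign_liftPerm, Fin.sign_cycleRange, Equiv.Perm.coe_mul,
          ← Function.comp_assoc]
        push_cast
        have h3 : (-1:ℚ)^j.val * (-1)^j.val = 1 := by rw [← mul_pow]; norm_num
        linear_combination (Equiv.Perm.sign σ : ℤ) * t ((w ∘ σ) ∘ liftPerm (Fin.cycleRange j)) * h3
      rw [Finset.sum_congr rfl fun j _ => h2 j, ← Finset.mul_sum]
      obtain ⟨r, hr⟩ : ∃ r, 2*(2*m) = r + 1 := ⟨2*(2*m) - 1, by omega⟩
      refine mul_eq_zero_of_right _ ?_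
      clear * - hl hr
      generalize w ∘ σ = v
      revert t v
      rw [hr]
      intro t hl v
      exact sum_HLsub_cycleRange hl v)
  have hzero := hE.eq_zero hab had hbc hbd hcd
    (fun σ => by rw [sum_fixer_eq_avg, havg]) 1
  simp [signed] at hzero
  exact hw hzero

/-! ## The stable range -/

lemma finrank_hSp_succ {g k : ℕ}
    (h : ∀ t ∈ hSp (g+1) k, pullback _ (inclLetter g) t = 0 → t = 0) :
    Module.finrank ℚ (hSp (g+1) k) = Module.finrank ℚ (hSp g k) := by
  have hinj : Function.Injective ((pullback (k+2) (inclLetter g)).domRestrict (hSp (g+1) k)) :=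
    (injective_iff_map_eq_zero _).2 fun t ht => Subtype.ext (h t t.2 ht)
  rw [← map_pullback_hSp (preservesOmega_inclLetter g) k, ← LinearMap.range_domRestrict,
    LinearMap.finrank_range_of_inj hinj]

/-- Theorem 1.2, first part: the stable range of
`dim h_{g,1}(2k)^{Sp}` is `g ≥ k` for odd `k` and `g ≥ k-1` for even `k`. -/
theorem stable_range_hSp :
    (∀ k : ℕ, 1 ≤ k → k % 2 = 1 → ∀ g : ℕ, k ≤ g →
      Module.finrank ℚ ↥(hSp g (2*k)) = Module.finrank ℚ ↥(hSp k (2*k))) ∧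
    (∀ k : ℕ, 2 ≤ k → k % 2 = 0 → ∀ g : ℕ, k - 1 ≤ g →
      Module.finrank ℚ ↥(hSp g (2*k)) = Module.finrank ℚ ↥(hSp (k-1) (2*k))) := by
  refine ⟨fun k _ _ g hg => ?_, fun k hk hk2 g hg => ?_⟩
  · induction g, hg using Nat.le_induction with
    | base => rfl
    | succ g hg ih =>
      exact (finrank_hSp_succ fun _ ht h0 => hSp_eq_zero_of_le hg ht h0).trans ih
  · obtain ⟨m, rfl⟩ : ∃ m, k = 2 * m := ⟨k / 2, by omega⟩
    induction g, hg using Nat.le_induction with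
    | base => rfl
    | succ g hg ih =>
      refine (finrank_hSp_succ fun _ ht h0 => ?_).trans ih
      rcases hg.eq_or_lt with rfl | hlt
      · exact hSp_eq_zero_of_even (by omega) ht h0
      · exact hSp_eq_zero_of_le (by omega) ht h0
end
end

section
/- For every g ≥ 1 and every k ≥ 1, the restriction of the symmetric bilinear form μ^{⊗2k} to the subspace (H^{⊗2k})^{Sp} of Sp(2g,ℚ)-invariant tensors is positive definite: every nonzero invariant ξ satisfies μ^{⊗2k}(ξ,ξ) > 0. -/
noncomputable section

open Finset

lemma omegaF_stdB_xI {g : ℕ} (u : HH g) (i : Fin g) : omegaF u (stdB g (xI i)) = -u (yI i) := by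
  have hy (j : Fin g) : yI j ≠ xI i := by simp only [xI, yI, ne_eq, Fin.mk.injEq]; omega
  have hx (j : Fin g) : xI j = xI i ↔ j = i := by
    simp only [xI, Fin.ext_iff]; omega
  simp [omegaF, stdB, hx, hy]

lemma omegaF_stdB_yI {g : ℕ} (u : HH g) (i : Fin g) : omegaF u (stdB g (yI i)) = u (xI i) := by
  have hx (j : Fin g) : xI j ≠ yI i := by simp only [xI, yI, ne_eq, Fin.mk.injEq]; omega
  have hy (j : Fin g) : yI j = yI i ↔ j = i := by
    simp only [yI, Fin.ext_iff]; omega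
  simp [omegaF, stdB, hx, hy]

lemma eq_xI_or_eq_yI {g : ℕ} (b : Fin (2*g)) : ∃ i : Fin g, b = xI i ∨ b = yI i := by
  refine ⟨⟨b / 2, by omega⟩, ?_⟩
  simp only [xI, yI, Fin.ext_iff]
  omega

/-- The complex structure `u ↦ ∑ b, ω(u, e_b) e_b` on `H`, sending `x_i` to `y_i` and `y_i` to
`-x_i`. -/
def complexStructure (g : ℕ) : HH g →ₗ[ℚ] HH g where
  toFun u b := omegaF u (stdB g b)
  map_add' u v := by
    funext b
    simp only [omegaF, Pi.add_apply, ← Finset.sum_add_distrib]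
    exact Finset.sum_congr rfl fun _ _ => by ring
  map_smul' c u := by
    funext b
    simp only [omegaF, Pi.smul_apply, smul_eq_mul, RingHom.id_apply, Finset.mul_sum]
    exact Finset.sum_congr rfl fun _ _ => by ring

lemma complexStructure_xI {g : ℕ} (u : HH g) (i : Fin g) :
    complexStructure g u (xI i) = -u (yI i) := omegaF_stdB_xI u i

lemma complexStructure_yI {g : ℕ} (u : HH g) (i : Fin g) :
    complexStructure g u (yI i) = u (xI i) := omegaF_stdB_yI u i

lemma complexStructure_complexStructure {g : ℕ} (u : HH g) :
    complexStructure g (complexStructure g u) = -u := by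
  funext b
  obtain ⟨i, rfl | rfl⟩ := eq_xI_or_eq_yI b <;>
    simp [complexStructure_xI, complexStructure_yI]

/-- `complexStructure` as a linear automorphism. -/
def complexStructureEquiv (g : ℕ) : HH g ≃ₗ[ℚ] HH g :=
  LinearEquiv.ofLinearMap (complexStructure g) (-complexStructure g)
    (LinearMap.ext fun u => by simp [complexStructure_complexStructure])
    (LinearMap.ext fun u => by simp [complexStructure_complexStructure])

lemma complexStructureEquiv_mem_SpSet (g : ℕ) : complexStructureEquiv g ∈ SpSet g := by
  intro u v
  change omegaF (complexStructure g u) (complexStructure g v) = _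
  simp only [omegaF, complexStructure_xI, complexStructure_yI]
  exact Finset.sum_congr rfl fun _ _ => by ring

lemma muF_eq_sum_mul_tensMapF {g m : ℕ} (ξ η : Tens g m) :
    muF ξ η = ∑ w, η w * tensMapF (complexStructureEquiv g) ξ w := by
  rw [muF, Finset.sum_comm]
  refine Finset.sum_congr rfl fun w' _ => ?_
  rw [tensMapF, Finset.mul_sum]
  refine Finset.sum_congr rfl fun w _ => ?_
  change ξ w * η w' * ∏ i, omegaB g (w i) (w' i) = η w' * (ξ w * ∏ i, omegaB g (w i) (w' i))
  ring

/-- On `Sp`-invariant tensors `μ^{⊗m}` is the standard Euclidean form. -/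
lemma muF_eq_sum_mul_of_mem_spInv {g m : ℕ} {ξ : Tens g m} (hξ : ξ ∈ spInv g m) (η : Tens g m) :
    muF ξ η = ∑ w, η w * ξ w := by
  rw [muF_eq_sum_mul_tensMapF, hξ _ (complexStructureEquiv_mem_SpSet g)]

/-- Theorem 2.6, positivity: the canonical bilinear form `μ^{⊗2k}`
is positive definite on the `Sp(2g,ℚ)`-invariant tensors. -/
theorem muF_posdef_on_invariants (g k : ℕ) (hg : 1 ≤ g) (hk : 1 ≤ k) :
    ∀ ξ ∈ spInv g (2*k), ξ ≠ 0 → 0 < muF ξ ξ := by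
  intro ξ hξ hne
  rw [muF_eq_sum_mul_of_mem_spInv hξ]
  obtain ⟨w, hw⟩ := Function.ne_iff.mp hne
  exact Finset.sum_pos' (fun w _ => mul_self_nonneg (ξ w))
    ⟨w, Finset.mem_univ w, mul_self_pos.mpr hw⟩
end
end

section
/- For all g ≥ 1 and k ≥ 1, the natural projection p : H_{g+1} → H_g (with p(x_{g+1})=p(y_{g+1})=0), applied factorwise to tensor powers, maps the Sp(2(g+1),ℚ)-invariant part of h_{g+1,1}(k) into the Sp(2g,ℚ)-invariant part of h_{g,1}(k): p(h_{g+1,1}(k)^{Sp}) ⊆ h_{g,1}(k)^{Sp}. -/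
noncomputable section

open Finset

/-! ## Stabilization maps -/

/-- the map `i^{⊗m} : H_g^{⊗m} → H_{g+1}^{⊗m}` induced by the natural inclusion `H_g ⊆ H_{g+1}` -/
def inclT {g m : ℕ} (t : Tens g m) : Tens (g+1) m :=
  fun w => if h : ∀ i, (w i).val < 2*g then t (fun i => ⟨(w i).val, h i⟩) else 0

/-- the map `p^{⊗m} : H_{g+1}^{⊗m} → H_g^{⊗m}` induced by the projection
`p : H_{g+1} → H_g` killing `x_{g+1}, y_{g+1}` -/
def projT {g m : ℕ} (t : Tens (g+1) m) : Tens g m :=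
  fun w => t (fun i => Fin.castLE (by omega) (w i))

/-- the inclusion of basis indices of `H_g` into those of `H_{g+1}` -/
def idxIncl {g : ℕ} (a : Fin (2*g)) : Fin (2*(g+1)) := Fin.castLE (by omega) a

/-- the projection `H_{g+1} → H_g` as a map of vectors -/
def projV {g : ℕ} (v : HH (g+1)) : HH g := fun a => v (idxIncl a)

/-- `f ⊕ id` on `H_{g+1} = H_g ⊕ ⟨x_{g+1}, y_{g+1}⟩` -/
def extendMap {g : ℕ} (f : HH g →ₗ[ℚ] HH g) : HH (g+1) →ₗ[ℚ] HH (g+1) where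
  toFun v := fun b => if h : b.val < 2*g then f (projV v) ⟨b.val, h⟩ else v b
  map_add' u v := by
    have h : projV (u + v) = projV u + projV v := rfl
    funext b
    by_cases hb : b.val < 2*g <;> simp [hb, h]
  map_smul' c v := by
    have h : projV (c • v) = c • projV v := rfl
    funext b
    by_cases hb : b.val < 2*g <;> simp [hb, h]

lemma extendMap_idxIncl {g : ℕ} (f : HH g →ₗ[ℚ] HH g) (v : HH (g+1)) (a : Fin (2*g)) :
    extendMap f v (idxIncl a) = f (projV v) a := by
  simp [extendMap, idxIncl]

lemma extendMap_of_le {g : ℕ} (f : HH g →ₗ[ℚ] HH g) (v : HH (g+1)) {b : Fin (2*(g+1))}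
    (hb : 2*g ≤ b.val) : extendMap f v b = v b := by
  simp [extendMap, hb]

lemma projV_extendMap {g : ℕ} (f : HH g →ₗ[ℚ] HH g) (v : HH (g+1)) :
    projV (extendMap f v) = f (projV v) :=
  funext fun a => extendMap_idxIncl f v a

lemma extendMap_comp_of_comp_eq_id {g : ℕ} {f f' : HH g →ₗ[ℚ] HH g}
    (h : f ∘ₗ f' = LinearMap.id) : extendMap f ∘ₗ extendMap f' = LinearMap.id := by
  refine LinearMap.ext fun v => funext fun b => ?_
  rcases lt_or_ge b.val (2*g) with hb | hb
  · obtain ⟨a, rfl⟩ : ∃ a : Fin (2*g), idxIncl a = b := ⟨⟨b.val, hb⟩, rfl⟩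
    have := congrFun (LinearMap.congr_fun h (projV v)) a
    simpa [extendMap_idxIncl, projV_extendMap, projV] using this
  · simp [extendMap_of_le _ _ hb]

/-- `f ⊕ id` as a linear automorphism -/
def extendEquiv {g : ℕ} (f : HH g ≃ₗ[ℚ] HH g) : HH (g+1) ≃ₗ[ℚ] HH (g+1) :=
  LinearEquiv.ofLinearMap (extendMap f.toLinearMap) (extendMap f.symm.toLinearMap)
    (extendMap_comp_of_comp_eq_id (by ext; simp))
    (extendMap_comp_of_comp_eq_id (by ext; simp))

lemma extendEquiv_apply {g : ℕ} (f : HH g ≃ₗ[ℚ] HH g) (v : HH (g+1)) :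
    extendEquiv f v = extendMap f.toLinearMap v := rfl

lemma omegaF_succ {g : ℕ} (u v : HH (g+1)) :
    omegaF u v = omegaF (projV u) (projV v) +
      (u (xI (Fin.last g)) * v (yI (Fin.last g)) -
        u (yI (Fin.last g)) * v (xI (Fin.last g))) := by
  rw [omegaF, Fin.sum_univ_castSucc]
  rfl

lemma extendEquiv_mem_SpSet {g : ℕ} {f : HH g ≃ₗ[ℚ] HH g} (hf : f ∈ SpSet g) :
    extendEquiv f ∈ SpSet (g+1) := by
  intro u v
  have hx : 2*g ≤ (xI (Fin.last g)).val := by simp [xI]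
  have hy : 2*g ≤ (yI (Fin.last g)).val := by simp [yI]
  simp only [omegaF_succ, extendEquiv_apply, projV_extendMap, extendMap_of_le _ _ hx,
    extendMap_of_le _ _ hy, LinearEquiv.coe_coe, hf (projV u) (projV v)]

lemma projV_stdB_idxIncl {g : ℕ} (a : Fin (2*g)) :
    projV (stdB (g+1) (idxIncl a)) = stdB g a := by
  funext b
  simp [projV, stdB, idxIncl]

lemma projV_stdB_of_le {g : ℕ} {b : Fin (2*(g+1))} (hb : 2*g ≤ b.val) :
    projV (stdB (g+1) b) = 0 := by
  funext a
  have : idxIncl a ≠ b := fun h => by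
    have := congrArg Fin.val h
    simp only [idxIncl, Fin.val_castLE] at this
    omega
  simp [projV, stdB, this]

lemma projT_tensMapF_extendEquiv {g m : ℕ} (f : HH g ≃ₗ[ℚ] HH g) (t : Tens (g+1) m) :
    projT (tensMapF (extendEquiv f) t) = tensMapF f (projT t) := by
  funext w'
  refine (Fintype.sum_of_injective (fun (w : Fin m → Fin (2*g)) i => idxIncl (w i)) ?_
    _ _ ?_ ?_).symm
  · intro w₁ w₂ h
    funext i
    exact Fin.castLE_injective _ (congrFun h i)
  · intro w hw
    obtain ⟨i, hi⟩ : ∃ i, 2*g ≤ (w i).val := by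
      by_contra! h
      exact hw ⟨fun i => ⟨(w i).val, h i⟩, rfl⟩
    refine mul_eq_zero_of_right _ (Finset.prod_eq_zero (Finset.mem_univ i) ?_)
    change extendMap f.toLinearMap (stdB (g+1) (w i)) (idxIncl (w' i)) = 0
    rw [extendMap_idxIncl, projV_stdB_of_le hi]
    simp
  · intro w
    refine congrArg (projT t w * ·) (Finset.prod_congr rfl fun i _ => ?_)
    change _ = extendMap f.toLinearMap (stdB (g+1) (idxIncl (w i))) (idxIncl (w' i))
    rw [extendMap_idxIncl, projV_stdB_idxIncl]
    rfl

lemma projT_mem_spInv {g m : ℕ} {t : Tens (g+1) m} (ht : t ∈ spInv (g+1) m) :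
    projT t ∈ spInv g m := by
  intro f hf
  rw [← projT_tensMapF_extendEquiv, ht _ (extendEquiv_mem_SpSet hf)]

/-- `projT` as a linear map -/
def projTL (g m : ℕ) : Tens (g+1) m →ₗ[ℚ] Tens g m where
  toFun := projT
  map_add' _ _ := rfl
  map_smul' _ _ := rfl

lemma projT_leftNormed {g : ℕ} : ∀ (m : ℕ) (u : Fin (m+1) → HH (g+1)),
    projT (leftNormed (g+1) m u) = leftNormed g m (fun i => projV (u i))
  | 0, _ => rfl
  | m+1, u => by
    rw [leftNormed, leftNormed, ← projT_leftNormed m]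
    rfl

lemma projT_mem_Lsub {g m : ℕ} {t : Tens (g+1) (m+1)} (ht : t ∈ Lsub (g+1) m) :
    projT t ∈ Lsub g m := by
  suffices Lsub (g+1) m ≤ (Lsub g m).comap (projTL g (m+1)) from this ht
  refine Submodule.span_le.2 ?_
  rintro _ ⟨u, rfl⟩
  exact Submodule.subset_span ⟨_, (projT_leftNormed m u).symm⟩

lemma projT_mem_HLsub {g k : ℕ} {t : Tens (g+1) (k+2)} (ht : t ∈ HLsub (g+1) k) :
    projT t ∈ HLsub g k := by
  suffices HLsub (g+1) k ≤ (HLsub g k).comap (projTL g (k+2)) from this ht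
  refine Submodule.span_le.2 ?_
  rintro _ ⟨u, ξ, hξ, rfl⟩
  exact Submodule.subset_span ⟨projV u, projT ξ, projT_mem_Lsub hξ, rfl⟩

lemma betaFun_projT {g m : ℕ} (t : Tens (g+1) (m+1)) :
    betaFun (projT t) = projT (betaFun t) := by
  funext w
  refine congrArg (projT t w - t ·) (funext fun i => ?_)
  cases i using Fin.cases <;> rfl

lemma projT_mem_hgl {g k : ℕ} {t : Tens (g+1) (k+2)} (ht : t ∈ hgl (g+1) k) :
    projT t ∈ hgl g k := by
  refine ⟨projT_mem_HLsub ht.1, ?_⟩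
  have h : betaFun t = 0 := ht.2
  change betaFun (projT t) = 0
  rw [betaFun_projT, h]
  rfl

/-- Proposition 3.4 (iii): the projection `H_{g+1} → H_g` maps
`h_{g+1,1}(k)^{Sp}` into `h_{g,1}(k)^{Sp}`. -/
theorem hSp_p_stable (g k : ℕ) (hg : 1 ≤ g) (hk : 1 ≤ k) :
    ∀ t ∈ hgl (g+1) k ⊓ spInv (g+1) (k+2), projT t ∈ hgl g k ⊓ spInv g (k+2) := by
  exact fun t ht => ⟨projT_mem_hgl ht.1, projT_mem_spInv ht.2⟩
end
end

section
/- For every g ≥ 1, the space j_{g,1}(2) = Ker(H ⊗ I_g(3) → I_g(4)) is one-dimensional over ℚ, spanned by the element Σ_{i=1}^g ( x_i ⊗ [y_i, ω_0] − y_i ⊗ [x_i, ω_0] ). -/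
noncomputable section

open Finset

/-! ## The symplectic element and the ideal it generates -/

/-- the symplectic element `ω_0 = Σ_i (x_i ⊗ y_i - y_i ⊗ x_i) = Σ_i [x_i, y_i]` -/
def omega0T (g : ℕ) : Tens g 2 := fun w => omegaB g (w 0) (w 1)

/-- the graded pieces `I_g(m)` of the Lie ideal of `L_{g,1}` generated by `ω_0` -/
def Isub (g : ℕ) : (m : ℕ) → Submodule ℚ (Tens g m)
  | 0 => ⊥
  | 1 => ⊥
  | 2 => Submodule.span ℚ {omega0T g}
  | (m+3) => Submodule.span ℚ
      {t | ∃ (u : HH g) (ξ : Tens g (m+2)), ξ ∈ Isub g (m+2) ∧ t = oneBrkt u ξ}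

/-- `H ⊗ I_g(k+1)` inside `H^{⊗(k+2)}` -/
def HIsub (g k : ℕ) : Submodule ℚ (Tens g (k+2)) :=
  Submodule.span ℚ {t | ∃ (u : HH g) (ξ : Tens g (k+1)), ξ ∈ Isub g (k+1) ∧ t = oneTmul u ξ}

/-- `j_{g,1}(k) = Ker ([·,·] : H ⊗ I_g(k+1) → I_g(k+2))` -/
def jgl (g k : ℕ) : Submodule ℚ (Tens g (k+2)) :=
  HIsub g k ⊓ LinearMap.ker (betaL g (k+1))

/-- the element `Σ_{i=1}^g (x_i ⊗ [y_i, ω_0] - y_i ⊗ [x_i, ω_0]) ∈ H^{⊗4}` -/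
def zetaT (g : ℕ) : Tens g 4 :=
  ∑ i : Fin g,
    (oneTmul (stdB g (xI i)) (oneBrkt (stdB g (yI i)) (omega0T g))
     - oneTmul (stdB g (yI i)) (oneBrkt (stdB g (xI i)) (omega0T g)))

theorem stdB_comm {g : ℕ} (a b : Fin (2*g)) : stdB g a b = stdB g b a := by
  simp only [stdB, eq_comm]

theorem omegaB_swap {g : ℕ} (a b : Fin (2*g)) : omegaB g b a = -omegaB g a b := by
  simp only [omegaB, omegaF, ← Finset.sum_neg_distrib]
  exact Finset.sum_congr rfl fun i _ => by ring

theorem omegaB_self {g : ℕ} (a : Fin (2*g)) : omegaB g a a = 0 := by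
  linarith [omegaB_swap a a]

theorem omegaB_xI_yI {g : ℕ} (j : Fin g) : omegaB g (xI j) (yI j) = 1 := by
  have h1 : ∀ i : Fin g, (xI i = xI j) ↔ i = j := fun i => by
    simp only [xI, Fin.ext_iff]; omega
  have h2 : ∀ i : Fin g, (yI i = yI j) ↔ i = j := fun i => by
    simp only [yI, Fin.ext_iff]; omega
  have h3 : ∀ i : Fin g, ¬ (yI i = xI j) := fun i => by
    simp only [xI, yI, Fin.ext_iff]; omega
  simp [omegaB, omegaF, stdB, h1, h2, h3]

theorem exists_omegaB_ne_zero {g : ℕ} (a : Fin (2*g)) : ∃ b, omegaB g a b ≠ 0 := by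
  obtain ⟨n, hn⟩ := a
  rcases Nat.even_or_odd' n with ⟨k, rfl | rfl⟩
  · exact ⟨yI ⟨k, by omega⟩, by
      rw [show (⟨2*k, hn⟩ : Fin (2*g)) = xI ⟨k, by omega⟩ from rfl, omegaB_xI_yI]; norm_num⟩
  · exact ⟨xI ⟨k, by omega⟩, by
      rw [show (⟨2*k+1, hn⟩ : Fin (2*g)) = yI ⟨k, by omega⟩ from rfl, omegaB_swap,
        omegaB_xI_yI]; norm_num⟩

theorem zetaT_apply {g : ℕ} (w : Fin 4 → Fin (2*g)) :
    zetaT g w = omegaB g (w 0) (w 1) * omegaB g (w 2) (w 3)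
      - omegaB g (w 0) (w 3) * omegaB g (w 1) (w 2) := by
  have h : ∀ a b, omegaB g a b
      = ∑ i : Fin g, (stdB g (xI i) a * stdB g (yI i) b - stdB g (yI i) a * stdB g (xI i) b) :=
    fun a b => by simp only [omegaB, omegaF, stdB_comm]
  rw [h (w 0) (w 1), h (w 0) (w 3), Finset.sum_mul, Finset.sum_mul, ← Finset.sum_sub_distrib,
    zetaT, Finset.sum_apply]
  refine Finset.sum_congr rfl fun i _ => ?_
  simp only [Pi.sub_apply, oneTmul, oneBrkt, omega0T]
  change stdB g (xI i) (w 0) * (stdB g (yI i) (w 1) * omegaB g (w 2) (w 3)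
      - omegaB g (w 1) (w 2) * stdB g (yI i) (w 3))
    - stdB g (yI i) (w 0) * (stdB g (xI i) (w 1) * omegaB g (w 2) (w 3)
      - omegaB g (w 1) (w 2) * stdB g (xI i) (w 3)) = _
  ring

/-- Elements of `I_g(3)` have the form `[v, ω_0]`. -/
theorem exists_of_mem_Isub_three {g : ℕ} {ξ : Tens g 3} (h : ξ ∈ Isub g 3) :
    ∃ v : HH g, ξ = oneBrkt v (omega0T g) := by
  rw [Isub] at h
  induction h using Submodule.span_induction with
  | mem x hx =>
    obtain ⟨u, η, hη, rfl⟩ := hx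
    rw [Isub] at hη
    obtain ⟨k, rfl⟩ := Submodule.mem_span_singleton.1 hη
    refine ⟨k • u, ?_⟩
    funext w
    simp only [oneBrkt, Pi.smul_apply, smul_eq_mul]
    ring
  | zero => exact ⟨0, by funext w; simp [oneBrkt]⟩
  | add x y _ _ hx hy =>
    obtain ⟨u, rfl⟩ := hx
    obtain ⟨v, rfl⟩ := hy
    refine ⟨u + v, ?_⟩
    funext w
    simp only [oneBrkt, Pi.add_apply]
    ring
  | smul k x _ hx =>
    obtain ⟨u, rfl⟩ := hx
    refine ⟨k • u, ?_⟩
    funext w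
    simp only [oneBrkt, Pi.smul_apply, smul_eq_mul]
    ring

/-- Elements of `H ⊗ I_g(3)` have the form `∑ c_{ab} e_a ⊗ [e_b, ω_0]`. -/
theorem exists_of_mem_HIsub_two {g : ℕ} {t : Tens g 4} (h : t ∈ HIsub g 2) :
    ∃ c : Fin (2*g) → Fin (2*g) → ℚ, ∀ w, t w
      = c (w 0) (w 1) * omegaB g (w 2) (w 3) - c (w 0) (w 3) * omegaB g (w 1) (w 2) := by
  rw [HIsub] at h
  induction h using Submodule.span_induction with
  | mem x hx =>
    obtain ⟨u, ξ, hξ, rfl⟩ := hx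
    obtain ⟨v, rfl⟩ := exists_of_mem_Isub_three hξ
    refine ⟨fun a b => u a * v b, fun w => ?_⟩
    change u (w 0) * (v (w 1) * omegaB g (w 2) (w 3) - omegaB g (w 1) (w 2) * v (w 3)) = _
    ring
  | zero => exact ⟨0, fun w => by simp⟩
  | add x y _ _ hx hy =>
    obtain ⟨c, hc⟩ := hx
    obtain ⟨d, hd⟩ := hy
    refine ⟨c + d, fun w => ?_⟩
    simp only [Pi.add_apply, hc, hd]
    ring
  | smul k x _ hx =>
    obtain ⟨c, hc⟩ := hx
    refine ⟨k • c, fun w => ?_⟩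
    simp only [Pi.smul_apply, smul_eq_mul, hc]
    ring

theorem betaL_apply_four {g : ℕ} (t : Tens g 4) (w : Fin 4 → Fin (2*g)) :
    betaL g 3 t w = t w - t ![w 3, w 0, w 1, w 2] := by
  change t w - t _ = _
  congr 2
  funext i
  fin_cases i <;> rfl

theorem zetaT_mem_HIsub (g : ℕ) : zetaT g ∈ HIsub g 2 := by
  have h : ∀ u v : HH g, oneTmul u (oneBrkt v (omega0T g)) ∈ HIsub g 2 := fun u v => by
    refine Submodule.subset_span ⟨u, _, ?_, rfl⟩
    rw [Isub]
    refine Submodule.subset_span ⟨v, _, ?_, rfl⟩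
    rw [Isub]
    exact Submodule.mem_span_singleton_self _
  exact Submodule.sum_mem _ fun i _ => Submodule.sub_mem _ (h _ _) (h _ _)

theorem zetaT_mem_jgl (g : ℕ) : zetaT g ∈ jgl g 2 := by
  refine ⟨zetaT_mem_HIsub g, ?_⟩
  rw [SetLike.mem_coe, LinearMap.mem_ker]
  funext w
  rw [betaL_apply_four, zetaT_apply, zetaT_apply]
  change _ - (omegaB g (w 3) (w 0) * omegaB g (w 1) (w 2)
    - omegaB g (w 3) (w 2) * omegaB g (w 0) (w 1)) = 0
  rw [omegaB_swap (w 0) (w 3), omegaB_swap (w 2) (w 3)]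
  ring

/-- A coefficient matrix of an element of `j_{g,1}(2)` is a multiple of that of `ω`. -/
theorem eq_mul_omegaB_of_cyclic {g : ℕ} (c : Fin (2*g) → Fin (2*g) → ℚ)
    (h : ∀ p q r s, c p q * omegaB g r s - c p s * omegaB g q r
      = c s p * omegaB g q r - c s r * omegaB g p q)
    (j : Fin g) (p q : Fin (2*g)) : c p q = c (xI j) (yI j) * omegaB g p q := by
  have diag : ∀ a, c a a = 0 := fun a => by
    obtain ⟨b, hb⟩ := exists_omegaB_ne_zero a
    have e := h a a b a
    rw [omegaB_swap a b, omegaB_self] at e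
    have e' : c a a * omegaB g a b = 0 := by linarith
    exact (mul_eq_zero.1 e').resolve_right hb
  have anti : ∀ a d, c d a = -c a d := fun a d => by
    obtain ⟨b, hb⟩ := exists_omegaB_ne_zero a
    have e := h a a b d
    rw [diag, omegaB_self] at e
    have e' : (c d a + c a d) * omegaB g a b = 0 := by linarith
    linarith [(mul_eq_zero.1 e').resolve_right hb]
  have e := h p q (xI j) (yI j)
  rw [omegaB_xI_yI, anti p (yI j), anti (xI j) (yI j)] at e
  linarith

/-- `j_{g,1}(2)` is one-dimensional, spanned by
`Σ_i (x_i ⊗ [y_i,ω_0] - y_i ⊗ [x_i,ω_0])`. -/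
theorem jgl_two (g : ℕ) (hg : 1 ≤ g) :
    jgl g 2 = Submodule.span ℚ {zetaT g} ∧ zetaT g ≠ 0 := by
  refine ⟨le_antisymm (fun t ht => ?_) ?_, fun h0 => ?_⟩
  · obtain ⟨c, hc⟩ := exists_of_mem_HIsub_two ht.1
    have key : ∀ p q r s, c p q * omegaB g r s - c p s * omegaB g q r
        = c s p * omegaB g q r - c s r * omegaB g p q := fun p q r s => by
      have e := congrFun (LinearMap.mem_ker.1 ht.2) ![p, q, r, s]
      rw [betaL_apply_four, hc, hc] at e
      exact sub_eq_zero.1 e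
    have hcΩ := eq_mul_omegaB_of_cyclic c key ⟨0, hg⟩
    refine Submodule.mem_span_singleton.2 ⟨c (xI ⟨0, hg⟩) (yI ⟨0, hg⟩), ?_⟩
    funext w
    rw [hc, hcΩ (w 0) (w 1), hcΩ (w 0) (w 3), Pi.smul_apply, smul_eq_mul, zetaT_apply]
    ring
  · rw [Submodule.span_singleton_le_iff_mem]
    exact zetaT_mem_jgl g
  · let j : Fin g := ⟨0, hg⟩
    have e := congrFun h0 ![xI j, yI j, xI j, yI j]
    rw [zetaT_apply] at e
    change omegaB g (xI j) (yI j) * omegaB g (xI j) (yI j)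
      - omegaB g (xI j) (yI j) * omegaB g (yI j) (xI j) = 0 at e
    rw [omegaB_swap (xI j) (yI j), omegaB_xI_yI] at e
    norm_num at e
end
end

section
/- Let g ≥ 1 and k ≥ 1. Set x := x_1, y := y_1 ∈ H, and define X_l ∈ H^{⊗(l+1)} by X_1 := x⊗y − y⊗x and X_l := x⊗X_{l−1} − X_{l−1}⊗x for l ≥ 2 (so X_l = ad(x)^l(y) in the tensor algebra with [a,b] = a⊗b − b⊗a). Define ε_{2k} := 2·y⊗X_{2k} + 2·x⊗[X_{2k−1}, y] + Σ_{i=1}^{2k−2} (−1)^{i+1}· x⊗[X_i, X_{2k−1−i}] ∈ H^{⊗(2k+2)}. Then K_{12}(ε_{2k}) lies in the span of { v − σ_{2k}·v : v ∈ H^{⊗2k} }; equivalently, the Enomoto–Satoh image of ε_{2k} in the cyclic coinvariants (H^{⊗2k})_{ℤ/2k} vanishes. -/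
noncomputable section

open Finset

/-! ## The Enomoto–Satoh contraction and cyclic coinvariants -/

/-- the contraction `K_{12} : H^{⊗(m+2)} → H^{⊗m}`,
`u_1 ⊗ u_2 ⊗ u_3 ⊗ ⋯ ↦ ω(u_1,u_2) · u_3 ⊗ ⋯` -/
def K12 {g m : ℕ} (t : Tens g (m+2)) : Tens g m :=
  fun w => ∑ a : Fin (2*g), ∑ b : Fin (2*g), omegaB g a b * t (Fin.cons a (Fin.cons b w))

/-- the cyclic permutation acting on `H^{⊗m}` -/
def cycT {g m : ℕ} (t : Tens g m) : Tens g m := fun w => t (fun i => w (finRotate m i))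

/-- the span of `{ v - σ_m · v }`, i.e. the kernel of the projection to the
cyclic coinvariants `(H^{⊗m})_{ℤ/m}` -/
def cycSpan (g m : ℕ) : Submodule ℚ (Tens g m) :=
  Submodule.span ℚ {t | ∃ v : Tens g m, t = v - cycT v}

/-- the bracket `[ξ,η] ∈ H^{⊗(k+l+2)}` of `ξ ∈ H^{⊗(k+2)}` and `η ∈ H^{⊗(l+2)}`,
extending the Lie bracket of the symplectic derivation Lie algebra -/
def brT {g k l : ℕ} (ξ : Tens g (k+2)) (η : Tens g (l+2)) : Tens g (k+l+2) :=
  fun w =>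
    (∑ p : Fin (k+2), if p.val = 0 then 0 else
      ∑ a : Fin (2*g), ∑ b : Fin (2*g), omegaB g a b *
        ξ (fun q : Fin (k+2) =>
            if q.val < p.val then w ⟨q.val, by have := q.isLt; omega⟩
            else if q.val = p.val then a
            else w ⟨q.val + l, by have := q.isLt; omega⟩) *
        η (fun r : Fin (l+2) =>
            if r.val = 0 then b
            else w ⟨p.val + r.val - 1, by have := p.isLt; have := r.isLt; omega⟩))
    -
    (∑ p : Fin (l+2), if p.val = 0 then 0 else
      ∑ a : Fin (2*g), ∑ b : Fin (2*g), omegaB g b a *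
        η (fun r : Fin (l+2) =>
            if r.val < p.val then w ⟨r.val, by have := r.isLt; omega⟩
            else if r.val = p.val then b
            else w ⟨r.val + k, by have := r.isLt; omega⟩) *
        ξ (fun q : Fin (k+2) =>
            if q.val = 0 then a
            else w ⟨p.val + q.val - 1, by have := p.isLt; have := q.isLt; omega⟩))

/-! ## The elements `X_l` and `ε_{2k}` -/

/-- `X_l = ad(x)^l (y)` in the tensor algebra (`X_0 = y`) -/
def Xl {g : ℕ} (x y : HH g) : (l : ℕ) → Tens g (l+1)
  | 0 => fun w => y (w 0)
  | (l+1) => oneBrkt x (Xl x y l)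

/-- transport a tensor along an equality of degrees -/
def castT {g m n : ℕ} (h : m = n) (t : Tens g m) : Tens g n :=
  fun w => t (fun i => w (Fin.cast h i))

/-- the bracket `[A,B] = A ⊗ B - B ⊗ A` of arbitrary tensors -/
def tBrkt {g m n : ℕ} (A : Tens g m) (B : Tens g n) : Tens g (m+n) :=
  fun w => A (fun i => w ⟨i.val, by have := i.isLt; omega⟩)
             * B (fun j => w ⟨m + j.val, by have := j.isLt; omega⟩)
         - B (fun j => w ⟨j.val, by have := j.isLt; omega⟩)
             * A (fun i => w ⟨n + i.val, by have := i.isLt; omega⟩)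

/-- `ε_{2k}` for `k = k'+1`:
`ε_{2k} = 2·y⊗X_{2k} + 2·x⊗[X_{2k-1},y] + Σ_{i=1}^{2k-2} (-1)^{i+1} x⊗[X_i, X_{2k-1-i}]` -/
def epsT (g : ℕ) (x y : HH g) (k' : ℕ) : Tens g (2*k'+4) :=
  (2:ℚ) • oneTmul y (Xl x y (2*k'+2)) +
  (2:ℚ) • oneTmul x (- oneBrkt y (Xl x y (2*k'+1))) +
  ∑ i ∈ Finset.Icc 1 (2*k'),
    ((-1:ℚ)^(i+1)) • oneTmul x
      (if h : 1 ≤ i ∧ i ≤ 2*k' then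
        castT (by omega) (tBrkt (Xl x y i) (Xl x y (2*k'+1-i)))
       else 0)

/-! ## Tensors as functions of infinite words -/

section Words

variable {α : Type*}

/-- the infinite word `a s_0 s_1 …` -/
def prependLetter (a : α) (s : ℕ → α) : ℕ → α
  | 0 => a
  | n+1 => s n

/-- the sum of `F` over the first `n` shifts of an infinite word -/
def shiftSum (n : ℕ) (F : (ℕ → α) → ℚ) (s : ℕ → α) : ℚ :=
  ∑ j ∈ range n, F (fun i => s (i + j))

theorem shiftSum_comp_shift {n : ℕ} (F : (ℕ → α) → ℚ) {s : ℕ → α} (hs : Function.Periodic s n)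
    (c : ℕ) : shiftSum n (fun s => F (fun i => s (i + c))) s = shiftSum n F s := by
  induction c with
  | zero => rfl
  | succ c ih =>
    rw [← ih]
    have h := Finset.sum_range_succ' (fun j => F (fun i => s (i + c + j))) n
    rw [Finset.sum_range_succ] at h
    have h0 : (fun i => s (i + c + n)) = fun i => s (i + c + 0) := by
      funext i; exact hs _
    rw [h0, add_left_inj] at h
    simp only [shiftSum]
    rw [h]
    refine Finset.sum_congr rfl fun j _ => congrArg F (funext fun i => congrArg s ?_)
    ring

/-- the coefficient of `ad(x)^l (y)` at the initial segment of length `l+1` of an infinite word -/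
def adCoeff (x y : α → ℚ) : ℕ → (ℕ → α) → ℚ
  | 0, s => y (s 0)
  | l+1, s => x (s 0) * adCoeff x y l (fun i => s (i + 1)) - adCoeff x y l s * x (s (l + 1))

variable {x y : α → ℚ} {a b : α}

theorem adCoeff_prepend_right (hx : x b = 0) (hy : y b = 1) (l : ℕ) (s : ℕ → α) :
    adCoeff x y l (prependLetter b s) = (-1) ^ l * ∏ i ∈ range l, x (s i) := by
  induction l with
  | zero => simp [adCoeff, prependLetter, hy]
  | succ l ih =>
    rw [adCoeff, ih, Finset.prod_range_succ]
    simp only [prependLetter, hx]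
    ring

theorem adCoeff_prepend_left_succ (hx : x a = 1) (l : ℕ) (s : ℕ → α) :
    adCoeff x y (l + 1) (prependLetter a s) =
      adCoeff x y l s - adCoeff x y l (prependLetter a s) * x (s l) := by
  rw [adCoeff]
  simp only [prependLetter, hx, one_mul]

theorem shiftSum_adCoeff_mul_pow {n l : ℕ} (hl : l + 2 ≤ n) {s : ℕ → α}
    (hs : Function.Periodic s n) :
    shiftSum n (fun s => adCoeff x y (l + 1) s * ∏ i ∈ Ico (l + 2) n, x (s i)) s = 0 := by
  have h := shiftSum_comp_shift
    (fun s => adCoeff x y l s * ∏ i ∈ Ico (l + 1) n, x (s i)) hs 1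
  rw [← sub_eq_zero] at h
  rw [← h]
  simp only [shiftSum]
  rw [← Finset.sum_sub_distrib]
  refine Finset.sum_congr rfl fun j _ => ?_
  have h1 : s (n + j) = s (0 + j) := by rw [add_comm n, zero_add]; exact hs j
  have h2 : ∏ i ∈ Ico (l + 1) n, x (s (i + 1 + j)) =
      (∏ i ∈ Ico (l + 2) n, x (s (i + j))) * x (s (0 + j)) := by
    rw [Finset.prod_Ico_add' (fun i => x (s (i + j))) (l + 1) n 1,
      Finset.prod_Ico_succ_top (show l + 1 + 1 ≤ n by omega), h1]
  have h3 : ∏ i ∈ Ico (l + 1) n, x (s (i + j)) =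
      x (s (l + 1 + j)) * ∏ i ∈ Ico (l + 2) n, x (s (i + j)) :=
    Finset.prod_eq_prod_Ico_succ_bot (show l + 1 < n by omega) _
  rw [adCoeff, h2, h3]
  ring

theorem shiftSum_adCoeff_prepend_left (hx : x a = 1) (hy : y a = 0) {n l : ℕ} (hl : l + 1 ≤ n)
    {s : ℕ → α} (hs : Function.Periodic s n) :
    shiftSum n (fun s => adCoeff x y (l + 1) (prependLetter a s) *
        ∏ i ∈ Ico (l + 1) n, x (s i)) s =
      (-1) ^ l * shiftSum n (fun s => y (s 0) * ∏ i ∈ Ico 1 n, x (s i)) s := by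
  induction l with
  | zero =>
    simp only [adCoeff_prepend_left_succ hx]
    simp [adCoeff, prependLetter, hy]
  | succ l ih =>
    have h := shiftSum_adCoeff_mul_pow (x := x) (y := y) hl hs
    rw [pow_succ, mul_neg_one, neg_mul, ← ih (by omega), ← zero_sub, ← h]
    simp only [shiftSum]
    rw [← Finset.sum_sub_distrib]
    refine Finset.sum_congr rfl fun j _ => ?_
    rw [adCoeff_prepend_left_succ hx (l + 1),
      Finset.prod_eq_prod_Ico_succ_bot (show l + 1 < n by omega)]
    ring

theorem shiftSum_pow_mul_adCoeff {p q : ℕ} (hq : 1 ≤ q) {s : ℕ → α}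
    (hs : Function.Periodic s (p + q + 1)) :
    shiftSum (p + q + 1)
      (fun s => (∏ i ∈ range p, x (s i)) * adCoeff x y q (fun i => s (i + p))) s = 0 := by
  obtain ⟨l, rfl⟩ : ∃ l, q = l + 1 := ⟨q - 1, by omega⟩
  rw [← shiftSum_adCoeff_mul_pow (x := x) (y := y) (show l + 2 ≤ p + (l + 1) + 1 by omega) hs,
    ← shiftSum_comp_shift
      (fun s => adCoeff x y (l + 1) s * ∏ i ∈ Ico (l + 2) (p + (l + 1) + 1), x (s i)) hs p]
  refine Finset.sum_congr rfl fun j _ => ?_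
  beta_reduce
  rw [mul_comm, Finset.prod_Ico_eq_prod_range, show p + (l + 1) + 1 - (l + 2) = p by omega]
  congr 1
  refine Finset.prod_congr rfl fun i _ => congrArg x ?_
  rw [← hs]
  congr 1
  ring

theorem shiftSum_pow_mul {n : ℕ} {s : ℕ → α} (hs : Function.Periodic s (n + 1)) :
    shiftSum (n + 1) (fun s => (∏ i ∈ range n, x (s i)) * y (s n)) s =
      shiftSum (n + 1) (fun s => y (s 0) * ∏ i ∈ Ico 1 (n + 1), x (s i)) s := by
  rw [← shiftSum_comp_shift (fun s => y (s 0) * ∏ i ∈ Ico 1 (n + 1), x (s i)) hs n]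
  refine Finset.sum_congr rfl fun j _ => ?_
  beta_reduce
  rw [mul_comm, Finset.prod_Ico_eq_prod_range, Nat.add_sub_cancel, zero_add]
  congr 1
  refine Finset.prod_congr rfl fun i _ => congrArg x ?_
  rw [← hs]
  congr 1
  ring

end Words

/-! ## Cyclic coinvariants and contraction on infinite words -/

theorem cycT_iterate_apply {g n : ℕ} (t : Tens g (n+1)) (c : ℕ) {s : ℕ → Fin (2*g)}
    (hs : Function.Periodic s (n + 1)) :
    (cycT^[c] t) (fun i => s i) = t (fun i => s (i + c)) := by
  induction c generalizing s with
  | zero => rfl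
  | succ c ih =>
    rw [Function.iterate_succ_apply']
    have h : (fun i : Fin (n+1) => s (finRotate (n+1) i)) = fun i : Fin (n+1) => s (i + 1) := by
      funext i
      rw [finRotate_apply, Fin.val_add_one]
      split_ifs with hi
      · subst hi
        simpa using (hs 0).symm
      · rfl
    rw [cycT, h, ih (s := fun i => s (i + 1)) (fun i => by
      beta_reduce; rw [add_right_comm]; exact hs _)]
    refine congrArg t (funext fun i => congrArg s ?_)
    ring

theorem sub_cycT_iterate_mem_cycSpan {g m : ℕ} (t : Tens g m) (c : ℕ) :
    t - cycT^[c] t ∈ cycSpan g m := by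
  induction c with
  | zero => simp
  | succ c ih =>
    have h : cycT^[c] t - cycT^[c+1] t ∈ cycSpan g m :=
      Submodule.subset_span ⟨cycT^[c] t, by rw [Function.iterate_succ_apply']⟩
    simpa using add_mem ih h

theorem mem_cycSpan_of_shiftSum_eq_zero {g n : ℕ} (t : Tens g (n+1))
    (h : ∀ s : ℕ → Fin (2*g), Function.Periodic s (n + 1) →
      shiftSum (n + 1) (fun s => t (fun i => s i)) s = 0) : t ∈ cycSpan g (n+1) := by
  have hsum : ∑ c ∈ range (n + 1), cycT^[c] t = 0 := by
    funext w
    have hs : Function.Periodic (fun i => w (Fin.ofNat (n + 1) i)) (n + 1) := fun i =>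
      congrArg w (by ext; simp [Fin.ofNat])
    rw [Finset.sum_apply, Pi.zero_apply, ← h _ hs]
    refine Finset.sum_congr rfl fun c _ => ?_
    beta_reduce
    rw [← cycT_iterate_apply t c hs]
    refine congrArg _ (funext fun i => congrArg w ?_)
    ext
    simp [Fin.ofNat, Nat.mod_eq_of_lt i.isLt]
  have hmem : ∑ c ∈ range (n + 1), (t - cycT^[c] t) ∈ cycSpan g (n+1) :=
    Submodule.sum_mem _ fun c _ => sub_cycT_iterate_mem_cycSpan t c
  rw [Finset.sum_sub_distrib, hsum, sub_zero, Finset.sum_const, Finset.card_range,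
    ← Nat.cast_smul_eq_nsmul ℚ] at hmem
  exact (Submodule.smul_mem_iff _ (by positivity)).1 hmem

theorem omegaB_xI_left {g : ℕ} (i : Fin g) (b : Fin (2*g)) :
    omegaB g (xI i) b = if b = yI i then 1 else 0 := by
  have h1 : ∀ j : Fin g, xI j = xI i ↔ j = i := fun j => by
    simp only [xI, Fin.ext_iff]; omega
  have h2 : ∀ j : Fin g, yI j ≠ xI i := fun j => by
    simp only [xI, yI, ne_eq, Fin.ext_iff]; omega
  rw [omegaB, omegaF, Finset.sum_eq_single i (fun j _ hj => by simp [stdB, h1, h2, hj]) (by simp)]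
  simp [stdB, h2, @eq_comm _ b]

theorem omegaB_yI_left {g : ℕ} (i : Fin g) (b : Fin (2*g)) :
    omegaB g (yI i) b = if b = xI i then -1 else 0 := by
  have h1 : ∀ j : Fin g, yI j = yI i ↔ j = i := fun j => by
    simp only [yI, Fin.ext_iff]; omega
  have h2 : ∀ j : Fin g, xI j ≠ yI i := fun j => by
    simp only [xI, yI, ne_eq, Fin.ext_iff]; omega
  rw [omegaB, omegaF, Finset.sum_eq_single i (fun j _ hj => by simp [stdB, h1, h2, hj]) (by simp)]
  simp [stdB, h2, @eq_comm _ b]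
  split_ifs <;> simp_all

theorem K12_apply_of_split {g m : ℕ} (i : Fin g) (t : Tens g (m+2))
    (P Q : (ℕ → Fin (2*g)) → ℚ)
    (h : ∀ s : ℕ → Fin (2*g), t (fun j => s j) =
      stdB g (xI i) (s 0) * P (fun j => s (j + 1)) + stdB g (yI i) (s 0) * Q (fun j => s (j + 1)))
    (s : ℕ → Fin (2*g)) :
    K12 t (fun j => s j) = P (prependLetter (yI i) s) - Q (prependLetter (xI i) s) := by
  have hcons : ∀ a b : Fin (2*g), (Fin.cons a (Fin.cons b fun j : Fin m => s j) :
      Fin (m+2) → Fin (2*g)) = fun j : Fin (m+2) => prependLetter a (prependLetter b s) j := by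
    intro a b
    funext j
    refine Fin.cases rfl (fun j => ?_) j
    exact Fin.cases rfl (fun j => rfl) j
  have hterm : ∀ a b : Fin (2*g), t (Fin.cons a (Fin.cons b fun j : Fin m => s j)) =
      stdB g (xI i) a * P (prependLetter b s) + stdB g (yI i) a * Q (prependLetter b s) := by
    intro a b
    rw [hcons, h]
    rfl
  simp only [K12, hterm, mul_add, Finset.sum_add_distrib]
  rw [Finset.sum_eq_single (xI i) (fun a _ ha => by simp [stdB, ha]) (by simp), add_comm,
    Finset.sum_eq_single (yI i) (fun a _ ha => by simp [stdB, ha]) (by simp)]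
  simp [omegaB_xI_left, omegaB_yI_left, stdB]
  ring

theorem Xl_apply {g : ℕ} (x y : HH g) (l : ℕ) (s : ℕ → Fin (2*g)) :
    Xl x y l (fun i => s i) = adCoeff x y l s := by
  induction l generalizing s with
  | zero => rfl
  | succ l ih =>
    rw [adCoeff, ← ih, ← ih]
    rfl

theorem tBrkt_Xl_apply {g : ℕ} (x y : HH g) (p q : ℕ) (s : ℕ → Fin (2*g)) :
    tBrkt (Xl x y p) (Xl x y q) (fun i => s i) =
      adCoeff x y p s * adCoeff x y q (fun i => s (p + 1 + i)) -
        adCoeff x y q s * adCoeff x y p (fun i => s (q + 1 + i)) := by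
  simp only [← Xl_apply]
  rfl

theorem epsT_apply {g : ℕ} (x y : HH g) (k : ℕ) (s : ℕ → Fin (2*g)) :
    epsT g x y k (fun i => s i) =
      x (s 0) * (-2 * (y (s 1) * adCoeff x y (2*k+1) (fun i => s (i + 2)) -
          adCoeff x y (2*k+1) (fun i => s (i + 1)) * y (s (2*k+3))) +
        ∑ p ∈ Icc 1 (2*k), (-1) ^ (p + 1) *
          (adCoeff x y p (fun i => s (i + 1)) *
              adCoeff x y (2*k+1-p) (fun i => s (p + 1 + i + 1)) -
            adCoeff x y (2*k+1-p) (fun i => s (i + 1)) *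
              adCoeff x y p (fun i => s (2*k+1-p + 1 + i + 1)))) +
      y (s 0) * (2 * adCoeff x y (2*k+2) (fun i => s (i + 1))) := by
  have hsum : ∀ p ∈ Icc 1 (2*k), (((-1:ℚ)^(p+1)) • oneTmul x
      (if h : 1 ≤ p ∧ p ≤ 2*k then
        castT (by omega) (tBrkt (Xl x y p) (Xl x y (2*k+1-p)))
       else 0) : Tens g (2*k+4)) (fun i => s i) = x (s 0) * ((-1) ^ (p + 1) *
          (adCoeff x y p (fun i => s (i + 1)) *
              adCoeff x y (2*k+1-p) (fun i => s (p + 1 + i + 1)) -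
            adCoeff x y (2*k+1-p) (fun i => s (i + 1)) *
              adCoeff x y p (fun i => s (2*k+1-p + 1 + i + 1)))) := by
    intro p hp
    rw [dif_pos (Finset.mem_Icc.1 hp)]
    have h := tBrkt_Xl_apply x y p (2*k+1-p) (fun i => s (i + 1))
    rw [← h, mul_left_comm]
    rfl
  rw [mul_add, Finset.mul_sum, ← Finset.sum_congr rfl hsum, ← Finset.sum_apply]
  simp only [← Xl_apply]
  simp only [epsT, Pi.add_apply, Pi.smul_apply, smul_eq_mul]
  have h1 : oneTmul y (Xl x y (2*k+2)) (fun i : Fin (2*k+4) => s i) =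
    y (s 0) * Xl x y (2*k+2) (fun i => s (i + 1)) := rfl
  have h2 : oneTmul x (- oneBrkt y (Xl x y (2*k+1))) (fun i : Fin (2*k+4) => s i) =
    x (s 0) * -(y (s 1) * Xl x y (2*k+1) (fun i => s (i + 2)) -
      Xl x y (2*k+1) (fun i => s (i + 1)) * y (s (2*k+3))) := rfl
  rw [h1, h2]
  ring

theorem shiftSum_contracted_eps {α : Type*} {x y : α → ℚ} {a b : α} (hxa : x a = 1)
    (hya : y a = 0) (hxb : x b = 0) (hyb : y b = 1) (k : ℕ) {s : ℕ → α}
    (hs : Function.Periodic s (2*k+2)) :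
    shiftSum (2*k+2) (fun s =>
      (-2 * (adCoeff x y (2*k+1) s -
          adCoeff x y (2*k+1) (prependLetter b s) * y (s (2*k+1))) +
        ∑ p ∈ Icc 1 (2*k), (-1) ^ (p + 1) *
          (adCoeff x y p (prependLetter b s) * adCoeff x y (2*k+1-p) (fun i => s (i + p)) -
            adCoeff x y (2*k+1-p) (prependLetter b s) *
              adCoeff x y p (fun i => s (i + (2*k+1-p))))) -
      2 * adCoeff x y (2*k+2) (prependLetter a s)) s = 0 := by
  have hX := shiftSum_adCoeff_mul_pow (x := x) (y := y) (le_refl (2*k+2)) hs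
  have hd := shiftSum_adCoeff_prepend_left (x := x) (y := y) hxa hya (le_refl (2*k+1+1)) hs
  rw [← shiftSum_pow_mul hs] at hd
  have hp : ∀ p q : ℕ, p + q = 2*k+1 → 1 ≤ q → shiftSum (2*k+2)
      (fun s => (∏ i ∈ range p, x (s i)) * adCoeff x y q (fun i => s (i + p))) s = 0 := by
    intro p q hpq hq
    rw [show 2*k+2 = p + q + 1 by omega] at hs ⊢
    exact shiftSum_pow_mul_adCoeff hq hs
  have hodd : (-1 : ℚ) ^ (2*k+1) = -1 := Odd.neg_one_pow ⟨k, rfl⟩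
  simp only [adCoeff_prepend_right hxb hyb]
  simp only [Ico_self, prod_empty, mul_one, hodd] at hX hd ⊢
  simp only [shiftSum] at hX hd hp ⊢
  simp only [Finset.sum_sub_distrib, Finset.sum_add_distrib, ← Finset.mul_sum, mul_assoc, hX, hd]
  rw [Finset.sum_comm]
  simp only [← Finset.mul_sum, Finset.sum_sub_distrib]
  rw [Finset.sum_eq_zero (s := Icc 1 (2*k))]
  · ring
  · intro p hpm
    have hpm := Finset.mem_Icc.1 hpm
    rw [hp p _ (by omega) (by omega), hp _ p (by omega) (by omega)]
    ring

theorem K12_epsT_mem_cycSpan {g : ℕ} (i : Fin g) (k m : ℕ) (h : 2*k+4 = m+2) :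
    K12 (castT h (epsT g (stdB g (xI i)) (stdB g (yI i)) k)) ∈ cycSpan g m := by
  obtain rfl : m = 2*k+1+1 := by omega
  have hxx : stdB g (xI i) (xI i) = 1 := by simp [stdB]
  have hyx : stdB g (yI i) (xI i) = 0 := by simp [stdB, xI, yI]
  have hxy : stdB g (xI i) (yI i) = 0 := by simp [stdB, xI, yI]
  have hyy : stdB g (yI i) (yI i) = 1 := by simp [stdB]
  refine mem_cycSpan_of_shiftSum_eq_zero _ fun s hs => ?_
  rw [← shiftSum_contracted_eps hxx hyx hxy hyy k hs]
  refine Finset.sum_congr rfl fun j _ => ?_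
  beta_reduce
  refine (K12_apply_of_split i (castT h (epsT g (stdB g (xI i)) (stdB g (yI i)) k))
    (fun s => -2 * (stdB g (yI i) (s 0) * adCoeff (stdB g (xI i)) (stdB g (yI i)) (2*k+1)
            (fun i => s (i + 1)) -
          adCoeff (stdB g (xI i)) (stdB g (yI i)) (2*k+1) s * stdB g (yI i) (s (2*k+2))) +
        ∑ p ∈ Icc 1 (2*k), (-1) ^ (p + 1) *
          (adCoeff (stdB g (xI i)) (stdB g (yI i)) p s *
              adCoeff (stdB g (xI i)) (stdB g (yI i)) (2*k+1-p) (fun i => s (p + 1 + i)) -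
            adCoeff (stdB g (xI i)) (stdB g (yI i)) (2*k+1-p) s *
              adCoeff (stdB g (xI i)) (stdB g (yI i)) p (fun i => s (2*k+1-p + 1 + i))))
    (fun s => 2 * adCoeff (stdB g (xI i)) (stdB g (yI i)) (2*k+2) s)
    (fun s => epsT_apply (stdB g (xI i)) (stdB g (yI i)) k s) (fun i => s (i + j))).trans ?_
  have hshift : ∀ (c l : ℕ), prependLetter (yI i) (fun i => s (i + j)) (c + 1 + l) =
      s (l + c + j) := by
    intro c l
    rw [show c + 1 + l = l + c + 1 by ring]
    rfl
  simp only [hshift]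
  simp only [prependLetter, hyy, one_mul]

/-- **Statement 17** (Theorem 8.5 (i)): the Enomoto–Satoh image of `ε_{2k}` vanishes,
i.e. `K_{12}(ε_{2k})` dies in the cyclic coinvariants `(H^{⊗2k})_{ℤ/2k}`. -/
theorem ES_eps_vanishes (g k : ℕ) (hg : 1 ≤ g) (hk : 1 ≤ k) :
    K12 (castT (by omega : 2*(k-1)+4 = 2*k+2)
      (epsT g (stdB g ⟨0, by omega⟩) (stdB g ⟨1, by omega⟩) (k-1))) ∈ cycSpan g (2*k) := by
  exact K12_epsT_mem_cycSpan ⟨0, hg⟩ (k-1) (2*k) (by omega)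
end
end
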